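/- Let G be a finite group of odd order |G| = p^a · q^b, where p and q are distinct primes, and suppose G has a Sylow subgroup that is either normal in G or abelian. Then for every primitive irreducible complex character χ of G there exists g ∈ G such that χ(1) divides |cl_G(g)|. -/

import Mathlib

open scoped Classical

/-- `χ : G → ℂ` is the character of some finite-dimensional complex representation of `G`. -/
def IsChar {G : Type*} [Group G] (χ : G → ℂ) : Prop :=
  ∃ (V : Type) (_ : AddCommGroup V) (_ : Module ℂ V) (_ : FiniteDimensional ℂ V)
    (ρ : Representation ℂ G V), ∀ g : G, χ g = LinearMap.trace ℂ V (ρ g)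

/-- `χ : G → ℂ` is the character of some irreducible finite-dimensional complex
representation of `G`. -/
def IsIrreducibleChar {G : Type*} [Group G] (χ : G → ℂ) : Prop :=
  ∃ (V : Type) (_ : AddCommGroup V) (_ : Module ℂ V) (_ : FiniteDimensional ℂ V)
    (ρ : Representation ℂ G V), Nontrivial V ∧
      (∀ U : Submodule ℂ V, (∀ g : G, ∀ v ∈ U, ρ g v ∈ U) → U = ⊥ ∨ U = ⊤) ∧
      ∀ g : G, χ g = LinearMap.trace ℂ V (ρ g)

/-- The class function of `G` induced from the function `ψ` on a subgroup `H`. -/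
noncomputable def inducedChar {G : Type*} [Group G] [Fintype G] (H : Subgroup G)
    (ψ : ↥H → ℂ) : G → ℂ :=
  fun g => (Nat.card H : ℂ)⁻¹ *
    ∑ x : G, if h : x⁻¹ * g * x ∈ H then ψ ⟨x⁻¹ * g * x, h⟩ else 0

/-- An irreducible character is primitive if it is not induced from a character of any
proper subgroup. -/
def IsPrimitiveChar {G : Type*} [Group G] [Fintype G] (χ : G → ℂ) : Prop :=
  IsIrreducibleChar χ ∧
    ∀ H : Subgroup G, H ≠ ⊤ → ∀ ψ : ↥H → ℂ, IsChar ψ → χ ≠ inducedChar H ψ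

/-- The size of the conjugacy class of `g` in `G`. -/
noncomputable def classSize {G : Type*} [Group G] (g : G) : ℕ :=
  Nat.card {x : G // IsConj g x}

/-- The `p`-part of a natural number `n`, i.e. the largest power of `p` dividing `n`. -/
def pPart (p n : ℕ) : ℕ := p ^ (n.factorization p)

/-- Only scalars commute with `ρ n` for all `n ∈ N`. -/
def ScalarCommutant {G V : Type*} [Group G] [AddCommGroup V] [Module ℂ V]
    (ρ : Representation ℂ G V) (N : Subgroup G) : Prop :=
  ∀ T : V →ₗ[ℂ] V, (∀ n ∈ N, T * ρ n = ρ n * T) → ∃ c : ℂ, T = c • 1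

/-- There is no nontrivial system of imprimitivity, expressed through projections. -/
def NoImprimitivity {G V : Type*} [Group G] [AddCommGroup V] [Module ℂ V]
    (ρ : Representation ℂ G V) : Prop :=
  ∀ π : V →ₗ[ℂ] V, π * π = π → π ≠ 0 →
    (∀ g, π * ρ g = ρ g * π ∨ π * ρ g * π = 0) → π = 1

lemma scalarCommutant_top_of_irreducible {G V : Type*} [Group G] [AddCommGroup V] [Module ℂ V]
    [FiniteDimensional ℂ V] [Nontrivial V] (ρ : Representation ℂ G V)
    (h : ∀ U : Submodule ℂ V, (∀ g : G, ∀ v ∈ U, ρ g v ∈ U) → U = ⊥ ∨ U = ⊤) :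
    ScalarCommutant ρ ⊤ := by
  intro T hT
  obtain ⟨c, hc⟩ := Module.End.exists_eigenvalue T
  refine ⟨c, ?_⟩
  rcases h (Module.End.eigenspace T c) (fun g v hv => by
    rw [Module.End.mem_eigenspace_iff] at hv ⊢
    have := LinearMap.congr_fun (hT g trivial) v
    simp only [Module.End.mul_apply] at this
    rw [this, hv, map_smul]) with h1 | h1
  · exact absurd h1 hc
  · ext v
    have : v ∈ Module.End.eigenspace T c := h1 ▸ Submodule.mem_top
    simpa [Module.End.mem_eigenspace_iff] using this

lemma eq_inducedChar_of_projection {G V : Type*} [Group G] [Fintype G] [AddCommGroup V]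
    [Module ℂ V] [FiniteDimensional ℂ V] (ρ : Representation ℂ G V)
    (hirr : ScalarCommutant ρ ⊤) (π : V →ₗ[ℂ] V) (hπ : π * π = π) (h0 : π ≠ 0)
    (H : Subgroup G) (hH : ∀ g ∈ H, π * ρ g = ρ g * π) (hH' : ∀ g ∉ H, π * ρ g * π = 0)
    (g : G) :
    LinearMap.trace ℂ V (ρ g) =
      inducedChar H (fun h => LinearMap.trace ℂ V (ρ (h : G) * π)) g := by
  have hρ : ∀ x y : G, ρ x * ρ y = ρ (x * y) := fun x y => (map_mul ρ x y).symm
  obtain ⟨c, hc⟩ := hirr (∑ x : G, ρ x * π * ρ x⁻¹) (by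
    intro n _
    rw [Finset.sum_mul, Finset.mul_sum]
    refine Fintype.sum_equiv (Equiv.mulLeft n⁻¹) _ _ fun x => ?_
    simp only [Equiv.coe_mulLeft, mul_inv_rev, inv_inv]
    rw [mul_assoc, hρ, ← mul_assoc (ρ n), ← mul_assoc (ρ n), hρ]
    simp)
  have hcard : c = Nat.card H := by
    have h1 : (∑ x : G, ρ x * π * ρ x⁻¹) * π = c • π := by rw [hc, smul_mul_assoc, one_mul]
    have h2 : ∀ x : G, ρ x * π * ρ x⁻¹ * π = if x ∈ H then π else 0 := by
      intro x
      split_ifs with hx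
      · rw [mul_assoc (ρ x), hH _ (H.inv_mem hx), ← mul_assoc, hρ, mul_inv_cancel, map_one,
          one_mul, hπ]
      · have := hH' x⁻¹ (by simpa using hx)
        rw [mul_assoc, mul_assoc, ← mul_assoc π, this, mul_zero]
    rw [Finset.sum_mul, Finset.sum_congr rfl fun x _ => h2 x, ← Finset.sum_filter,
      Finset.sum_const, ← Nat.cast_smul_eq_nsmul ℂ] at h1
    have h3 := smul_left_injective ℂ h0 h1
    rw [← h3, Nat.card_eq_fintype_card, Fintype.card_subtype]
  have hne : (Nat.card H : ℂ) ≠ 0 := by exact_mod_cast Nat.card_pos.ne'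
  have key : ∀ x : G, (if h : x⁻¹ * g * x ∈ H then
      LinearMap.trace ℂ V (ρ ((⟨x⁻¹ * g * x, h⟩ : H) : G) * π) else 0) =
      LinearMap.trace ℂ V (ρ g * (ρ x * π * ρ x⁻¹)) := by
    intro x
    have e1 : LinearMap.trace ℂ V (ρ g * (ρ x * π * ρ x⁻¹)) =
        LinearMap.trace ℂ V (ρ (x⁻¹ * g * x) * π) := by
      rw [← mul_assoc, ← mul_assoc, LinearMap.trace_mul_comm, ← mul_assoc, hρ, hρ,
        mul_assoc x⁻¹]
    rw [e1]
    split_ifs with h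
    · rfl
    · have := hH' _ h
      rw [← hπ, ← mul_assoc, LinearMap.trace_mul_comm, ← mul_assoc, this, map_zero]
  simp only [inducedChar]
  rw [Finset.sum_congr rfl fun x _ => key x, ← map_sum, ← Finset.mul_sum, hc, hcard,
    mul_smul_comm, mul_one, map_smul, smul_eq_mul, inv_mul_cancel_left₀ hne]

lemma isChar_of_projection {H : Type*} [Group H] {V : Type} [AddCommGroup V] [Module ℂ V]
    [FiniteDimensional ℂ V] (ρ : Representation ℂ H V) (π : V →ₗ[ℂ] V) (hπ : π * π = π)
    (hc : ∀ h, π * ρ h = ρ h * π) : IsChar fun h => LinearMap.trace ℂ V (ρ h * π) := by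
  have hmem : ∀ h, ∀ v ∈ LinearMap.range π, ρ h v ∈ LinearMap.range π := by
    rintro h _ ⟨v, rfl⟩
    exact ⟨ρ h v, LinearMap.congr_fun (hc h) v⟩
  have hid : ∀ v ∈ LinearMap.range π, π v = v := by
    rintro _ ⟨v, rfl⟩
    exact LinearMap.congr_fun hπ v
  refine ⟨LinearMap.range π, inferInstance, inferInstance, inferInstance,
    { toFun := fun h => (ρ h).restrict (hmem h)
      map_one' := by ext; simp
      map_mul' := fun a b => by ext; simp }, fun h => ?_⟩
  have e1 : ρ h * π = (LinearMap.range π).subtype ∘ₗ (ρ h ∘ₗ π).codRestrict (LinearMap.range π)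
      (fun v => hmem h _ ⟨v, rfl⟩) := by ext; simp
  refine (congrArg (LinearMap.trace ℂ V) e1).trans ?_
  rw [LinearMap.trace_comp_comm']
  congr 1
  ext v
  simp [hid v v.2]

lemma exists_representation_of_isPrimitiveChar {G : Type*} [Group G] [Fintype G] {χ : G → ℂ}
    (hχ : IsPrimitiveChar χ) : ∃ (V : Type) (_ : AddCommGroup V) (_ : Module ℂ V)
      (_ : FiniteDimensional ℂ V) (ρ : Representation ℂ G V), Nontrivial V ∧
      ScalarCommutant ρ ⊤ ∧ NoImprimitivity ρ ∧ χ 1 = Module.finrank ℂ V := by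
  obtain ⟨⟨V, i1, i2, i3, ρ, hnt, hirr, htr⟩, hprim⟩ := hχ
  have hs := scalarCommutant_top_of_irreducible ρ hirr
  refine ⟨V, i1, i2, i3, ρ, hnt, hs, fun π hπ h0 hg => ?_, by simp [htr]⟩
  let H : Subgroup G :=
    { carrier := {g | π * ρ g = ρ g * π}
      one_mem' := by simp
      mul_mem' := fun {a b} ha hb => by
        simp only [Set.mem_ofPred_eq] at ha hb ⊢
        rw [map_mul, ← mul_assoc, ha, mul_assoc, hb, mul_assoc]
      inv_mem' := fun {a} ha => by
        simp only [Set.mem_ofPred_eq] at ha ⊢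
        have h1 : ρ a⁻¹ * ρ a = 1 := by rw [← map_mul]; simp
        have h2 : ρ a * ρ a⁻¹ = 1 := by rw [← map_mul]; simp
        calc π * ρ a⁻¹ = ρ a⁻¹ * (ρ a * π) * ρ a⁻¹ := by rw [← mul_assoc, h1, one_mul]
          _ = ρ a⁻¹ * π := by rw [← ha, mul_assoc, mul_assoc, h2, mul_one] }
  have hH : H = ⊤ := by
    by_contra hne
    refine hprim H hne (fun h => LinearMap.trace ℂ V (ρ (h : G) * π))
      (isChar_of_projection (ρ.comp H.subtype) π hπ fun h => h.2) (funext fun g => ?_)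
    rw [htr]
    exact eq_inducedChar_of_projection ρ hs π hπ h0 H (fun g hg => hg)
      (fun g hn => (hg g).resolve_left hn) g
  obtain ⟨c, hc⟩ := hs π (fun n _ => (hH ▸ Subgroup.mem_top n : n ∈ H))
  have h2 : c • π = π := by
    nth_rw 2 [← hπ]
    nth_rw 2 [hc]
    rw [smul_mul_assoc, one_mul]
  have h3 : (c - 1) • π = 0 := by rw [sub_smul, h2, one_smul, sub_self]
  rcases smul_eq_zero.mp h3 with h | h
  · rw [hc, sub_eq_zero.mp h, one_smul]
  · exact absurd h h0

section GroupSpan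

variable {G V : Type*} [Group G] [AddCommGroup V] [Module ℂ V]

/-- The subalgebra of `End V` spanned by the operators `ρ n` with `n ∈ N`. -/
noncomputable def groupSpan (ρ : Representation ℂ G V) (N : Subgroup G) :
    Subalgebra ℂ (V →ₗ[ℂ] V) :=
  (Representation.asAlgebraHom (ρ.comp N.subtype : Representation ℂ N V)).range

lemma mem_groupSpan (ρ : Representation ℂ G V) {N : Subgroup G} {n : G} (hn : n ∈ N) :
    ρ n ∈ groupSpan ρ N :=
  ⟨MonoidAlgebra.of ℂ N ⟨n, hn⟩, by
    exact Representation.asAlgebraHom_of (ρ.comp N.subtype : Representation ℂ N V) ⟨n, hn⟩⟩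

lemma groupSpan_le_of_submodule (ρ : Representation ℂ G V) (N : Subgroup G)
    (S : Submodule ℂ (V →ₗ[ℂ] V)) (h : ∀ n ∈ N, ρ n ∈ S) {T : V →ₗ[ℂ] V}
    (hT : T ∈ groupSpan ρ N) : T ∈ S := by
  obtain ⟨f, rfl⟩ := hT
  induction f using MonoidAlgebra.induction_on with
  | of g =>
    exact (Representation.asAlgebraHom_of (ρ.comp N.subtype : Representation ℂ N V) g).symm ▸
      h g g.2
  | add f g hf hg =>
    rw [map_add]
    exact S.add_mem hf hg
  | smul r f hf =>
    exact (congrArg (· ∈ S) (map_smul (Representation.asAlgebraHom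
      (ρ.comp N.subtype : Representation ℂ N V)) r f)).mpr (S.smul_mem r hf)

lemma commute_of_mem_groupSpan (ρ : Representation ℂ G V) (N : Subgroup G) {T A : V →ₗ[ℂ] V}
    (hT : ∀ n ∈ N, T * ρ n = ρ n * T) (hA : A ∈ groupSpan ρ N) : T * A = A * T :=
  groupSpan_le_of_submodule ρ N (LinearMap.ker (LinearMap.mulLeft ℂ T - LinearMap.mulRight ℂ T))
    (fun n hn => by simp [hT n hn]) hA |> fun h => by
      simpa [sub_eq_zero] using h

lemma conj_mem_groupSpan (ρ : Representation ℂ G V) (N : Subgroup G) [hN : N.Normal] (g : G)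
    {A : V →ₗ[ℂ] V} (hA : A ∈ groupSpan ρ N) : ρ g * A * ρ g⁻¹ ∈ groupSpan ρ N :=
  groupSpan_le_of_submodule ρ N ((groupSpan ρ N).toSubmodule.comap
      (LinearMap.mulRight ℂ (ρ g⁻¹) ∘ₗ LinearMap.mulLeft ℂ (ρ g)))
    (fun n hn => by
      have := mem_groupSpan ρ (hN.conj_mem n hn g)
      simpa [map_mul] using this) hA

instance isSemisimpleRing_groupSpan [Finite G] (ρ : Representation ℂ G V) (N : Subgroup G) :
    IsSemisimpleRing (groupSpan ρ N) :=
  haveI : NeZero (Nat.card N : ℂ) := ⟨by exact_mod_cast Nat.card_pos.ne'⟩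
  RingHom.isSemisimpleRing_of_surjective
    ((Representation.asAlgebraHom (ρ.comp N.subtype : Representation ℂ N V)).rangeRestrict.toRingHom)
    (AlgHom.rangeRestrict_surjective _)

lemma eq_of_idempotent_of_finrank_le [FiniteDimensional ℂ V] {e p : V →ₗ[ℂ] V} (he : e * e = e)
    (hep : p * e = e)
    (hr : Module.finrank ℂ (LinearMap.range p) ≤ Module.finrank ℂ (LinearMap.range e)) :
    e * p = p := by
  have hle : LinearMap.range e ≤ LinearMap.range p := by
    rintro _ ⟨v, rfl⟩
    exact ⟨e v, LinearMap.congr_fun hep v⟩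
  have heq := Submodule.eq_of_le_of_finrank_le hle hr
  ext v
  obtain ⟨w, hw⟩ : p v ∈ LinearMap.range e := heq ▸ ⟨v, rfl⟩
  rw [Module.End.mul_apply, ← hw]
  exact LinearMap.congr_fun he w

lemma eq_one_of_central_idempotent [FiniteDimensional ℂ V] {ρ : Representation ℂ G V}
    (hρ : NoImprimitivity ρ) (N : Subgroup G) [N.Normal] (e : V →ₗ[ℂ] V)
    (heA : e ∈ groupSpan ρ N) (hec : ∀ n ∈ N, e * ρ n = ρ n * e) (he : e * e = e) (h0 : e ≠ 0) :
    e = 1 := by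
  let S : Set (V →ₗ[ℂ] V) := {p | p ∈ groupSpan ρ N ∧ (∀ n ∈ N, p * ρ n = ρ n * p) ∧
    p * p = p ∧ p ≠ 0}
  have hS : e ∈ S := ⟨heA, hec, he, h0⟩
  let rk : (V →ₗ[ℂ] V) → ℕ := fun p => Module.finrank ℂ (LinearMap.range p)
  obtain ⟨p, ⟨hpA, hpc, hp, hp0⟩, hmin⟩ : ∃ p ∈ S, ∀ p' ∈ S, rk p ≤ rk p' := by
    obtain ⟨p, hp, h⟩ := (measure rk).wf.has_min S ⟨e, hS⟩
    exact ⟨p, hp, fun p' hp' => not_lt.mp (h p' hp')⟩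
  have hinv : ∀ g : G, ρ g * ρ g⁻¹ = 1 := fun g => by rw [← map_mul]; simp
  have hinv' : ∀ g : G, ρ g⁻¹ * ρ g = 1 := fun g => by rw [← map_mul]; simp
  have hp1 : p = 1 := by
    refine hρ p hp hp0 fun g => ?_
    set p' := ρ g * p * ρ g⁻¹ with hp'
    have hp'A : p' ∈ groupSpan ρ N := conj_mem_groupSpan ρ N g hpA
    have hcomm : p * p' = p' * p := commute_of_mem_groupSpan ρ N hpc hp'A
    have hp'p' : p' * p' = p' := by
      calc p' * p' = ρ g * p * (ρ g⁻¹ * ρ g) * p * ρ g⁻¹ := by rw [hp']; noncomm_ring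
        _ = p' := by rw [hinv', mul_one, mul_assoc (ρ g), hp]
    have hp'g : p' * ρ g = ρ g * p := by rw [hp', mul_assoc, hinv', mul_one]
    by_cases hz : p * p' = 0
    · right
      rw [mul_assoc, ← hp'g, ← mul_assoc, hz, zero_mul]
    left
    have hee : p * p' * (p * p') = p * p' := by
      calc p * p' * (p * p') = p * (p' * p) * p' := by noncomm_ring
        _ = (p * p) * (p' * p') := by rw [← hcomm]; noncomm_ring
        _ = p * p' := by rw [hp, hp'p']
    have hmem : p * p' ∈ S := ⟨mul_mem hpA hp'A, fun n hn => by
      have h1 : p' * ρ n = ρ n * p' := by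
        have := commute_of_mem_groupSpan ρ N hpc
          (conj_mem_groupSpan ρ N g⁻¹ (mem_groupSpan ρ hn))
        rw [inv_inv] at this
        calc p' * ρ n = ρ g * (p * (ρ g⁻¹ * ρ n * ρ g)) * ρ g⁻¹ := by
              rw [hp']; simp only [mul_assoc, hinv, mul_one]
          _ = (ρ g * ρ g⁻¹) * ρ n * p' := by rw [this, hp']; noncomm_ring
          _ = ρ n * p' := by rw [hinv, one_mul]
      rw [mul_assoc, h1, ← mul_assoc, hpc n hn, mul_assoc], hee, hz⟩
    have h1 : p * p' * p = p :=
      eq_of_idempotent_of_finrank_le hee (by rw [← mul_assoc, hp]) (hmin _ hmem)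
    have hrk : rk p' ≤ rk p := by
      have : LinearMap.range p' ≤ (LinearMap.range p).map (ρ g) := by
        rintro _ ⟨v, rfl⟩
        exact ⟨p (ρ g⁻¹ v), ⟨_, rfl⟩, rfl⟩
      exact (Submodule.finrank_mono this).trans (Submodule.finrank_map_le _ _)
    have h2 : p * p' * p' = p' :=
      eq_of_idempotent_of_finrank_le hee (by rw [hcomm, ← mul_assoc, hp'p'])
        (hrk.trans (hmin _ hmem))
    have h3 : p = p' := by
      rw [hcomm, mul_assoc, hp] at h1
      rw [mul_assoc, hp'p', hcomm] at h2
      rw [← h1]; exact h2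
    rw [← hp'g, ← h3]
  have := eq_of_idempotent_of_finrank_le he (p := 1) (by simp) (hp1 ▸ hmin e hS)
  simpa using this

lemma exists_groupSpan_algEquiv_matrix [Finite G] [FiniteDimensional ℂ V] [Nontrivial V]
    {ρ : Representation ℂ G V} (hρ : NoImprimitivity ρ) (N : Subgroup G) [N.Normal] :
    ∃ (d : ℕ), d ≠ 0 ∧
      Nonempty (groupSpan ρ N ≃ₐ[ℂ] Matrix (Fin d) (Fin d) ℂ) := by
  obtain ⟨n, d, hd, ⟨e⟩⟩ :=
    IsSemisimpleRing.exists_algEquiv_pi_matrix_of_isAlgClosed ℂ (groupSpan ρ N)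
  have hidem : ∀ i, e.symm (Pi.single i 1) = 1 := by
    intro i
    have hi : (Pi.single i 1 : ∀ i, Matrix (Fin (d i)) (Fin (d i)) ℂ) ≠ 0 := by
      have := hd i
      rw [Ne, Pi.single_eq_zero_iff]
      exact one_ne_zero
    have hc : ∀ x : groupSpan ρ N, e.symm (Pi.single i 1) * x = x * e.symm (Pi.single i 1) := by
      intro x
      apply e.injective
      simp only [map_mul, AlgEquiv.apply_symm_apply]
      ext j : 1
      by_cases hj : j = i
      · subst hj; simp
      · simp [hj]
    refine Subtype.ext (eq_one_of_central_idempotent hρ N _ (e.symm (Pi.single i 1)).2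
      (fun n hn => congrArg Subtype.val (hc ⟨ρ n, mem_groupSpan ρ hn⟩)) ?_ ?_)
    · rw [← MulMemClass.coe_mul, ← map_mul, ← Pi.single_mul, one_mul]
    · intro h
      have : e.symm (Pi.single i 1) = 0 := Subtype.ext h
      simp at this
  have hsub : ∀ i j : Fin n, i = j := by
    intro i j
    by_contra hij
    have h1 := e.symm.injective ((hidem i).trans (hidem j).symm)
    have h2 := congrFun h1 i
    have := hd i
    rw [Pi.single_eq_same, Pi.single_eq_of_ne hij] at h2
    exact one_ne_zero h2
  have hn : Nonempty (Fin n) := by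
    by_contra h
    have := not_nonempty_iff.mp h
    have h1 : (1 : groupSpan ρ N) = 0 := e.injective (Subsingleton.elim _ _)
    exact one_ne_zero h1
  obtain ⟨i⟩ := hn
  let u : Unique (Fin n) := ⟨⟨i⟩, fun j => hsub j i⟩
  exact ⟨d default, (hd default).ne, ⟨e.trans
    (AlgEquiv.ofRingEquiv (f := RingEquiv.piUnique fun i => Matrix (Fin (d i)) (Fin (d i)) ℂ)
      (fun r => rfl))⟩⟩

end GroupSpan

section MatrixSubalgebra

variable {E : Type*} [Ring E] [Algebra ℂ E] {d : ℕ} {A : Subalgebra ℂ E}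

lemma exists_smul_one_of_central (e : A ≃ₐ[ℂ] Matrix (Fin d) (Fin d) ℂ) {x : E} (hx : x ∈ A)
    (hc : ∀ y ∈ A, x * y = y * x) : ∃ c : ℂ, x = c • 1 := by
  have h1 : e ⟨x, hx⟩ ∈ Subalgebra.center ℂ (Matrix (Fin d) (Fin d) ℂ) := by
    rw [Subalgebra.mem_center_iff]
    intro M
    obtain ⟨y, rfl⟩ := e.surjective M
    rw [← map_mul, ← map_mul]
    exact congrArg e (Subtype.ext (hc y y.2).symm)
  obtain ⟨c, hc⟩ := Algebra.mem_bot.mp (Algebra.IsCentral.out h1)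
  refine ⟨c, ?_⟩
  have h2 : (⟨x, hx⟩ : A) = algebraMap ℂ A c := e.injective (by rw [← hc]; simp)
  have := congrArg Subtype.val h2
  simpa [Algebra.algebraMap_eq_smul_one] using this

lemma exists_unit_conj_eq [FiniteDimensional ℂ E] (e : A ≃ₐ[ℂ] Matrix (Fin d) (Fin d) ℂ)
    (u : Eˣ) (hu : ∀ x ∈ A, (u : E) * x * ↑u⁻¹ ∈ A) :
    ∃ a : Aˣ, ∀ x : A, (u : E) * x * ↑u⁻¹ = ((a * x * ↑a⁻¹ : A) : E) := by
  let f : A →ₐ[ℂ] A :=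
    { toFun := fun x => ⟨u * x * ↑u⁻¹, hu x x.2⟩
      map_one' := by ext; simp
      map_mul' := fun x y => by ext; simp [mul_assoc]
      map_zero' := by ext; simp
      map_add' := fun x y => by ext; simp [mul_add, add_mul]
      commutes' := fun c => by ext; simp [Algebra.algebraMap_eq_smul_one] }
  have hf : Function.Bijective f := by
    have hinj : Function.Injective f := fun x y hxy => by
      have := congrArg Subtype.val hxy
      exact Subtype.ext (by simpa [f] using this)
    exact ⟨hinj, (LinearMap.injective_iff_surjective (f := f.toLinearMap)).mp hinj⟩
  let L : A ≃ₐ[ℂ] Module.End ℂ (Fin d → ℂ) := e.trans Matrix.toLinAlgEquiv'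
  obtain ⟨T, hT⟩ := (L.symm.trans ((AlgEquiv.ofBijective f hf).trans L)).eq_linearEquivConjAlgEquiv
  let t : (Module.End ℂ (Fin d → ℂ))ˣ := ⟨T.toLinearMap, T.symm.toLinearMap,
    by ext; simp, by ext; simp⟩
  refine ⟨Units.map L.symm.toRingEquiv.toMonoidHom t, fun x => ?_⟩
  have h1 := congrArg (fun F => L.symm (F (L x))) hT
  simp only [AlgEquiv.trans_apply, AlgEquiv.symm_apply_apply, LinearEquiv.conjAlgEquiv_apply] at h1
  change ((f x : A) : E) = _
  refine congrArg Subtype.val (h1.trans ?_)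
  have h2 : T.toLinearMap ∘ₗ L x ∘ₗ T.symm.toLinearMap = ↑t * L x * ↑t⁻¹ := rfl
  rw [h2, map_mul, map_mul, L.symm_apply_apply]
  rfl

/-- If a matrix subalgebra together with a suitable set `U` of units normalizing it has only scalar
commutant, then `U` is contained in the subalgebra. -/
lemma units_subset_of_scalar_commutant [FiniteDimensional ℂ E] [Nontrivial E]
    (e : A ≃ₐ[ℂ] Matrix (Fin d) (Fin d) ℂ) (U : Set Eˣ)
    (hU : ∀ u ∈ U, ∀ x ∈ A, (u : E) * x * ↑u⁻¹ ∈ A)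
    (hs : ∀ T : E, (∀ x ∈ A, T * x = x * T) → (∀ u ∈ U, T * u = u * T) → ∃ c : ℂ, T = c • 1)
    (hc : U.Subsingleton ∨ (∀ u ∈ U, ∀ v ∈ U, u * v = v * u) ∧
      ∃ k : ℕ, k.Coprime d ∧ ∀ u ∈ U, u ^ k = 1) :
    ∀ u ∈ U, (u : E) ∈ A := by
  choose! a ha using fun u hu => exists_unit_conj_eq e u (hU u hu)
  let a' : Eˣ → Eˣ := fun u => Units.map A.val.toRingHom.toMonoidHom (a u)
  have ha'A : ∀ u, (a' u : E) ∈ A := fun u => (a u : A).2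
  have ha'A' : ∀ u, (↑(a' u)⁻¹ : E) ∈ A := fun u => (↑(a u)⁻¹ : A).2
  have ha' : ∀ u ∈ U, ∀ x ∈ A, (u : E) * x * ↑u⁻¹ = a' u * x * ↑(a' u)⁻¹ :=
    fun u hu x hx => ha u hu ⟨x, hx⟩
  let c : Eˣ → Eˣ := fun u => (a' u)⁻¹ * u
  have hu : ∀ u, u = a' u * c u := fun u => by simp [c]
  have hcA : ∀ u ∈ U, ∀ x ∈ A, (c u : E) * x = x * c u := by
    intro u hu x hx
    have h1 := ha' u hu x hx
    have h2 : (u : E) * x = a' u * x * ↑(a' u)⁻¹ * u := by rw [← h1]; simp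
    calc (c u : E) * x = ↑(a' u)⁻¹ * (↑u * x) := by simp [c, mul_assoc]
      _ = x * c u := by rw [h2]; simp [c, mul_assoc]
  have hcc : ∀ u ∈ U, ∀ v ∈ U, c u * c v = c v * c u := by
    intro u hu' v hv'
    rcases hc with hc | ⟨hcomm, k, hk, hpow⟩
    · rw [hc hu' hv']
    have hcau : ∀ u ∈ U, ∀ v, c u * a' v = a' v * c u :=
      fun u hu v => Units.ext (hcA u hu _ (ha'A v))
    have e1 : a' u * a' v * (c u * c v) = a' v * a' u * (c v * c u) := by
      have := hcomm u hu' v hv'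
      rw [hu u, hu v] at this
      calc _ = a' u * c u * (a' v * c v) := by
            rw [mul_assoc, ← mul_assoc (a' v), ← hcau u hu' v]; simp only [mul_assoc]
        _ = a' v * c v * (a' u * c u) := by
            rw [← hu u, ← hu v]; exact hcomm u hu' v hv'
        _ = _ := by
            rw [mul_assoc, ← mul_assoc (c v), hcau v hv' u]; simp only [mul_assoc]
    let g : Eˣ := (a' v * a' u)⁻¹ * (a' u * a' v)
    have hg : g = c v * c u * (c u * c v)⁻¹ := by
      rw [eq_mul_inv_iff_mul_eq, mul_assoc, inv_mul_eq_iff_eq_mul, e1]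
    have hgA : (g : E) ∈ A := by
      simp only [g, mul_inv_rev, Units.val_mul]
      exact mul_mem (mul_mem (ha'A' _) (ha'A' _)) (mul_mem (ha'A _) (ha'A _))
    have hcZ : ∀ w ∈ U, ∀ x ∈ A, Commute (c w : E) x := fun w hw x hx => hcA w hw x hx
    have hgc : ∀ x ∈ A, (g : E) * x = x * g := by
      intro x hx
      have h1 := hcZ u hu' x hx
      have h2 := hcZ v hv' x hx
      have : Commute (g : E) x := by
        rw [hg]
        simp only [mul_inv_rev, Units.val_mul]
        exact (h2.mul_left h1).mul_left (h2.units_inv_left.mul_left h1.units_inv_left)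
      exact this
    obtain ⟨γ, hγ⟩ := exists_smul_one_of_central e hgA hgc
    have hγ0 : γ ≠ 0 := by
      rintro rfl
      rw [zero_smul] at hγ
      exact g.ne_zero hγ
    have hdet : γ ^ d = 1 := by
      have h1 : (a u * a v : A) = γ • (a v * a u : A) := by
        have h2 : a' u * a' v = a' v * a' u * g := (mul_inv_cancel_left _ _).symm
        have h3 := congrArg Units.val h2
        rw [Units.val_mul _ g, hγ, mul_smul_comm, mul_one] at h3
        exact Subtype.ext h3
      have h2 := congrArg (fun x => (e x).det) h1
      simp only [map_mul, map_smul, Matrix.det_smul, Fintype.card_fin, Matrix.det_mul] at h2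
      have hdu : ∀ w, (e (a w)).det ≠ 0 := by
        intro w hw
        have h3 : (e (a w)).det * (e ↑(a w)⁻¹).det = 1 := by
          rw [← Matrix.det_mul, ← map_mul, Units.mul_inv, map_one, Matrix.det_one]
        rw [hw, zero_mul] at h3
        exact zero_ne_one h3
      have h4 : γ ^ d * ((e (a v)).det * (e (a u)).det) =
          1 * ((e (a v)).det * (e (a u)).det) := by rw [← h2, one_mul, mul_comm]
      exact mul_right_cancel₀ (mul_ne_zero (hdu v) (hdu u)) h4
    have hswap : c v * c u = g * (c u * c v) := by rw [hg, inv_mul_cancel_right]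
    have hkpow : γ ^ k = 1 := by
      have hcomm1 : Commute (a' u) (c u) := (hcau u hu' u).symm
      have h1 : c u ^ k = (a' u ^ k)⁻¹ := by
        have := hpow u hu'
        rw [hu u, hcomm1.mul_pow] at this
        exact (inv_eq_of_mul_eq_one_right this).symm
      have h2 : (↑(c u ^ k) : E) ∈ A := by
        rw [h1, ← inv_pow, Units.val_pow_eq_pow_val]
        exact pow_mem (ha'A' u) k
      have h3 : ∀ m : ℕ, (c v : E) * (c u : E) ^ m = γ ^ m • ((c u : E) ^ m * c v) := by
        intro m
        induction m with
        | zero => simp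
        | succ m ih =>
          have h4 : (c v : E) * c u = γ • (c u * c v) := by
            have : ((c v * c u : Eˣ) : E) = (g : E) * ((c u * c v : Eˣ) : E) :=
              congrArg Units.val hswap
            rw [hγ, smul_mul_assoc, one_mul] at this
            exact this
          rw [pow_succ, ← mul_assoc, ih, smul_mul_assoc, mul_assoc, h4, mul_smul_comm, smul_smul,
            ← mul_assoc, pow_succ, mul_assoc]
      have h5 := h3 k
      rw [← Units.val_pow_eq_pow_val, hcA v hv' _ h2] at h5
      have h6 : (γ ^ k - 1) • (((c u ^ k * c v : Eˣ)) : E) = 0 := by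
        rw [sub_smul, Units.val_mul, ← h5, one_smul, sub_self]
      rcases smul_eq_zero.mp h6 with h | h
      · exact sub_eq_zero.mp h
      · exact absurd h (Units.ne_zero _)
    have hγ1 : γ = 1 := by
      have h1 := orderOf_dvd_of_pow_eq_one hdet
      have h2 := orderOf_dvd_of_pow_eq_one hkpow
      exact orderOf_eq_one_iff.mp (Nat.eq_one_of_dvd_coprimes hk h2 h1)
    have hg1 : g = 1 := Units.ext (by rw [hγ, hγ1, one_smul, Units.val_one])
    rw [hswap, hg1, one_mul]
  intro u hu'
  obtain ⟨s, hs⟩ := hs (c u) (hcA u hu') (fun v hv => by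
    have h1 : c u * v = v * c u := by
      have h2 : c u * a' v = a' v * c u := Units.ext (hcA u hu' _ (ha'A v))
      calc c u * v = c u * (a' v * c v) := congrArg (c u * ·) (hu v)
        _ = a' v * (c u * c v) := by rw [← mul_assoc, h2, mul_assoc]
        _ = a' v * (c v * c u) := congrArg (a' v * ·) (hcc u hu' v hv)
        _ = a' v * c v * c u := (mul_assoc _ _ _).symm
        _ = v * c u := (congrArg (· * c u) (hu v)).symm
    exact congrArg Units.val h1)
  have h1 := congrArg Units.val (hu u)
  rw [Units.val_mul, hs, mul_smul_comm, mul_one] at h1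
  rw [h1]
  exact A.smul_mem (ha'A u) s

end MatrixSubalgebra

section GroupTheory

open scoped commutatorElement

variable {G : Type*} [Group G]

/-- If every abelian normal subgroup of `G` is central, then a normal `r`-subgroup has nilpotency
class at most two. -/
lemma commutator_le_center_of_abelian_normal [Finite G]
    (hG : ∀ N : Subgroup G, N.Normal → ⁅N, N⁆ = ⊥ → N ≤ Subgroup.center G)
    {r : ℕ} [Fact r.Prime] (R : Subgroup G) [R.Normal] (hR : IsPGroup r R) :
    ⁅R, R⁆ ≤ Subgroup.center G := by
  have hnorm : ∀ n, (R.lowerCentralSeries n).Normal := by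
    intro n
    induction n with
    | zero => exact ‹R.Normal›
    | succ n ih => rw [Subgroup.lowerCentralSeries_succ]; infer_instance
  have hcomm : ∀ H : Subgroup G, H ≤ Subgroup.center G → ∀ K : Subgroup G, ⁅H, K⁆ = ⊥ := by
    intro H hH K
    rw [Subgroup.commutator_eq_bot_iff_le_centralizer]
    exact hH.trans (Subgroup.center_le_centralizer _)
  have hstep : ∀ n, R.lowerCentralSeries (n + 2) ≤ Subgroup.center G →
      R.lowerCentralSeries (n + 1) ≤ Subgroup.center G := by
    intro n hn
    have := hnorm (n + 1)
    refine hG _ this ?_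
    rw [Subgroup.lowerCentralSeries_succ] at hn
    have h1 : ⁅⁅R, R⁆, R.lowerCentralSeries (n + 1)⁆ = ⊥ :=
      Subgroup.commutator_commutator_eq_bot_of_rotate
        (by rw [Subgroup.commutator_comm R]; exact hcomm _ hn _) (hcomm _ hn _)
    rw [eq_bot_iff, ← h1]
    exact Subgroup.commutator_mono (R.lowerCentralSeries_antitone (Nat.le_add_left 1 n)) le_rfl
  obtain ⟨n, hn⟩ := (Subgroup.isNilpotent_iff_lowerCentralSeries R).mp hR.isNilpotent
  have key : ∀ m, R.lowerCentralSeries (m + 1) ≤ Subgroup.center G →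
      R.lowerCentralSeries 1 ≤ Subgroup.center G := by
    intro m
    induction m with
    | zero => exact id
    | succ m ih => exact fun h => ih (hstep m h)
  exact key n ((R.lowerCentralSeries_antitone n.le_succ).trans (hn ▸ bot_le))

/-- If every abelian normal subgroup is central, then the second center is the center. -/
lemma mem_center_of_commutator_mem_center
    (hG : ∀ N : Subgroup G, N.Normal → ⁅N, N⁆ = ⊥ → N ≤ Subgroup.center G) {w : G}
    (hw : ∀ g : G, ⁅g, w⁆ ∈ Subgroup.center G) : w ∈ Subgroup.center G := by
  let N := Subgroup.center G ⊔ Subgroup.zpowers w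
  have hwN : w ∈ N := Subgroup.mem_sup_right (Subgroup.mem_zpowers w)
  have hN : N.Normal := by
    rw [← Subgroup.normalizer_eq_top_iff, eq_top_iff]
    rintro g -
    have hle : ∀ g : G, N ≤ N.comap (MulAut.conj g).toMonoidHom := by
      intro g
      refine sup_le (fun z hz => ?_) ?_
      · exact Subgroup.mem_sup_left (Subgroup.Normal.conj_mem inferInstance z hz g)
      · rw [Subgroup.zpowers_le]
        have : g * w * g⁻¹ = ⁅g, w⁆ * w := by simp [commutatorElement_def]
        change g * w * g⁻¹ ∈ N
        rw [this]
        exact mul_mem (Subgroup.mem_sup_left (hw g)) hwN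
    rw [Subgroup.mem_normalizer_iff]
    refine fun h => ⟨fun hh => hle g hh, fun hh => ?_⟩
    have := hle g⁻¹ hh
    simpa [mul_assoc] using this
  refine hG N hN ?_ hwN
  rw [Subgroup.commutator_eq_bot_iff_le_centralizer]
  refine sup_le (Subgroup.center_le_centralizer _) ?_
  rw [Subgroup.zpowers_le, ← Subgroup.zpowers_le, Subgroup.le_centralizer_iff]
  refine sup_le (Subgroup.center_le_centralizer _) ?_
  rw [Subgroup.zpowers_le, Subgroup.mem_centralizer_iff]
  intro h hh
  obtain ⟨i, rfl⟩ := Subgroup.mem_zpowers_iff.mp hh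
  exact (Commute.refl w).zpow_left i

/-- If every abelian normal subgroup of `G` is central, `G = T Y` with `T` an `r`-subgroup and `Y`
normal, then `Y` has no nontrivial fixed points on `R Z(G) / Z(G)` for any normal subgroup `R ≤ T`. -/
lemma mem_center_of_commutator_mem_center_of_sup_eq_top [Finite G]
    (hG : ∀ N : Subgroup G, N.Normal → ⁅N, N⁆ = ⊥ → N ≤ Subgroup.center G)
    {r : ℕ} [Fact r.Prime] (R T Y : Subgroup G) [R.Normal] [Y.Normal] (hT : IsPGroup r T)
    (hRT : R ≤ T) (hTY : T ⊔ Y = ⊤) {w : G} (hwR : w ∈ R)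
    (hw : ∀ y ∈ Y, ⁅y, w⁆ ∈ Subgroup.center G) : w ∈ Subgroup.center G := by
  let Z := Subgroup.center G
  let F : Subgroup G := (Subgroup.centralizer ((Y.map (QuotientGroup.mk' Z) : Subgroup (G ⧸ Z)) :
    Set (G ⧸ Z))).comap (QuotientGroup.mk' Z)
  have hmk : ∀ g w : G, ⁅g, w⁆ ∈ Z ↔ (g : G ⧸ Z) * w = w * g := by
    intro g w
    rw [← QuotientGroup.eq_one_iff, commutatorElement_def]
    change (g : G ⧸ Z) * w * (g : G ⧸ Z)⁻¹ * (w : G ⧸ Z)⁻¹ = 1 ↔ _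
    rw [mul_inv_eq_one, mul_inv_eq_iff_eq_mul]
  have hF : ∀ w, w ∈ F ↔ ∀ y ∈ Y, ⁅y, w⁆ ∈ Z := by
    intro w
    simp only [F, Subgroup.mem_comap, Subgroup.mem_centralizer_iff, hmk]
    constructor
    · exact fun h y hy => h _ ⟨y, hy, rfl⟩
    · rintro h _ ⟨y, hy, rfl⟩
      exact h y hy
  have hFn : F.Normal := by
    have : (Y.map (QuotientGroup.mk' Z)).Normal :=
      Subgroup.Normal.map inferInstance _ (QuotientGroup.mk'_surjective Z)
    infer_instance
  obtain ⟨n, hn⟩ := (Subgroup.isNilpotent_iff_lowerCentralSeries T).mp hT.isNilpotent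
  have key : ∀ m, R ⊓ F ⊓ T.lowerCentralSeries m ≤ Z := by
    intro m
    by_cases hm : n ≤ m
    · exact (inf_le_right.trans (T.lowerCentralSeries_antitone hm)).trans (hn ▸ bot_le)
    push Not at hm
    induction hm.le using Nat.decreasingInduction with
    | self => exact absurd hm (lt_irrefl _)
    | of_succ k hk ih =>
      have ih : R ⊓ F ⊓ T.lowerCentralSeries (k + 1) ≤ Z := by
        by_cases hk' : k + 1 < n
        · exact ih hk'
        · exact (inf_le_right.trans (T.lowerCentralSeries_antitone (not_lt.mp hk'))).trans
            (hn ▸ bot_le)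
      rintro w ⟨hwRF, hwT⟩
      refine mem_center_of_commutator_mem_center hG fun g => ?_
      let C : Subgroup G := (Subgroup.centralizer {(w : G ⧸ Z)}).comap (QuotientGroup.mk' Z)
      have hC : ∀ g, g ∈ C ↔ ⁅g, w⁆ ∈ Z := fun g => by
        simp only [C, Subgroup.mem_comap, Subgroup.mem_centralizer_singleton_iff, hmk]
        rfl
      have : (⊤ : Subgroup G) ≤ C := by
        rw [← hTY]
        refine sup_le (fun t ht => (hC t).mpr (ih ⟨?_, ?_⟩)) (fun y hy => (hC y).mpr
          ((hF w).mp hwRF.2 y hy))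
        · exact (Subgroup.commutator_le_right ⊤ (R ⊓ F))
            (Subgroup.commutator_mem_commutator (Subgroup.mem_top t) hwRF)
        · rw [Subgroup.lowerCentralSeries_succ, Subgroup.commutator_comm]
          exact Subgroup.commutator_mem_commutator ht hwT
      exact (hC g).mp (this (Subgroup.mem_top g))
  exact key 0 ⟨⟨hwR, (hF w).mpr hw⟩, hRT hwR⟩

lemma classSize_eq_index_centralizer (g : G) : classSize g = (Subgroup.centralizer {g}).index := by
  have h1 : (Subgroup.centralizer {g}).index = (MulAction.stabilizer (ConjAct G) g).index := by
    rw [ConjAct.stabilizer_eq_centralizer]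
    rfl
  rw [h1, MulAction.index_stabilizer, ConjAct.orbit_eq_carrier_conjClasses, classSize]
  refine Nat.card_congr (Equiv.subtypeEquivRight fun x => ?_)
  rw [ConjClasses.mem_carrier_iff_mk_eq, ConjClasses.mk_eq_mk_iff_isConj, isConj_comm]

lemma classSize_map_dvd {H : Type*} [Group H] (f : G →* H) (hf : Function.Surjective f) (g : G) :
    classSize (f g) ∣ classSize g := by
  rw [classSize_eq_index_centralizer, classSize_eq_index_centralizer,
    ← Subgroup.index_comap_of_surjective _ hf]
  refine Subgroup.index_dvd_of_le fun x hx => ?_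
  rw [Subgroup.mem_centralizer_singleton_iff] at hx
  rw [Subgroup.mem_comap, Subgroup.mem_centralizer_singleton_iff, ← map_mul, hx, map_mul]

end GroupTheory

section FixedPoints

lemma card_inf_mul_relIndex {G : Type*} [Group G] (A B : Subgroup G) :
    Nat.card (A ⊓ B : Subgroup G) * B.relIndex A = Nat.card A := by
  rw [← Subgroup.inf_relIndex_left A B, ← Subgroup.relIndex_bot_left,
    Subgroup.relIndex_mul_relIndex _ _ _ bot_le inf_le_left, Subgroup.relIndex_bot_left]

lemma relIndex_dvd_index_of_normal_right {G : Type*} [Group G] [Finite G] (C K : Subgroup G)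
    [K.Normal] : C.relIndex K ∣ C.index := by
  have h1 := card_inf_mul_relIndex K C
  have h2 := card_inf_mul_relIndex C K
  have h3 := card_inf_mul_relIndex (K ⊔ C) K
  have h4 := card_inf_mul_relIndex (K ⊔ C) C
  rw [inf_eq_right.mpr le_sup_left, Subgroup.relIndex_sup_left, ← h1] at h3
  rw [inf_eq_right.mpr le_sup_right, ← h3, inf_comm K C, mul_right_comm, h2] at h4
  rw [← Nat.eq_of_mul_eq_mul_left Nat.card_pos h4]
  exact Subgroup.relIndex_dvd_index_of_le le_sup_right

lemma card_mul_card_le_of_inf_eq_bot {G : Type*} [Group G] [Finite G] {A B W : Subgroup G}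
    (hA : A ≤ W) (hB : B ≤ W) (h : A ⊓ B = ⊥) : Nat.card A * Nat.card B ≤ Nat.card W := by
  rw [← Nat.card_prod]
  refine Nat.card_le_card_of_injective
    (fun g : A × B => (⟨g.1 * g.2, mul_mem (hA g.1.2) (hB g.2.2)⟩ : W)) fun x y hxy => ?_
  exact Subgroup.mul_injective_of_disjoint (disjoint_iff.mpr h) (congrArg Subtype.val hxy)

variable {S V : Type*} [Group S] [CommGroup V]

/-- The subgroup of elements of `V` fixed by the automorphism `φ x`. -/
def fixedBy (φ : S →* MulAut V) (x : S) : Subgroup V :=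
  (φ x).toMonoidHom.eqLocus (MonoidHom.id V)

lemma mem_fixedBy {φ : S →* MulAut V} {x : S} {v : V} : v ∈ fixedBy φ x ↔ φ x v = v := Iff.rfl

/-- The kernel of the action of `S` on an invariant subgroup `W`. -/
lemma exists_normal_ker (φ : S →* MulAut V) (W : Subgroup V) (hW : ∀ x, ∀ w ∈ W, φ x w ∈ W) :
    ∃ K : Subgroup S, K.Normal ∧ ∀ x, x ∈ K ↔ ∀ w ∈ W, φ x w = w := by
  refine ⟨⟨⟨⟨{x | ∀ w ∈ W, φ x w = w}, fun {x y} hx hy w hw => ?_⟩, fun w _ => ?_⟩,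
    fun {x} hx w hw => ?_⟩, ⟨fun x hx y w hw => ?_⟩, fun x => Iff.rfl⟩
  · rw [map_mul, MulAut.mul_apply, hy w hw, hx w hw]
  · simp
  · have h1 := hx w hw
    rw [map_inv]
    exact (MulEquiv.symm_apply_eq _).mpr h1.symm
  · rw [map_mul, map_mul, MulAut.mul_apply, MulAut.mul_apply, hx _ (hW _ w hw), map_inv,
      MulAut.apply_inv_self]

lemma prod_card_fixedBy_sq_le [Fintype S] [Finite V] {s : ℕ} [Fact s.Prime] (hS : IsPGroup s S)
    (φ : S →* MulAut V) (n : ℕ) : ∀ W : Subgroup V, Nat.card W = n →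
      (∀ x, ∀ w ∈ W, φ x w ∈ W) → (∀ w ∈ W, (∀ x, φ x w = w) → w = 1) →
      (∏ x : S, Nat.card (W ⊓ fixedBy φ x : Subgroup V)) ^ 2 ≤ Nat.card W ^ Fintype.card S := by
  induction n using Nat.strong_induction_on with
  | _ n ih =>
  intro W hn hW hfix
  by_cases hbot : W = ⊥
  · subst hbot
    simp
  obtain ⟨K, hKn, hK⟩ := exists_normal_ker φ W hW
  obtain ⟨x, hxK, hx⟩ : ∃ x : S, x ∉ K ∧ (x : S ⧸ K) ∈ Subgroup.center (S ⧸ K) := by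
    have hne : K ≠ ⊤ := by
      rintro rfl
      refine hbot ((Subgroup.eq_bot_iff_forall W).mpr fun w hw => hfix w hw fun x => ?_)
      exact (hK x).mp (Subgroup.mem_top x) w hw
    have : Nontrivial (S ⧸ K) := QuotientGroup.nontrivial_iff.mpr hne
    obtain ⟨z, hz, hz1⟩ := (Subgroup.nontrivial_iff_exists_ne_one _).mp
      (Subgroup.nontrivial_iff_ne_bot _ |>.mpr (hS.to_quotient K).bot_lt_center.ne')
    obtain ⟨x, rfl⟩ := QuotientGroup.mk_surjective z
    exact ⟨x, fun h => hz1 ((QuotientGroup.eq_one_iff x).mpr h), hz⟩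
  have hcomm : ∀ y, ∀ w ∈ W, φ x (φ y w) = φ y (φ x w) := by
    intro y w hw
    have h1 : ((x * y : S) : S ⧸ K) = ((y * x : S) : S ⧸ K) :=
      (Subgroup.mem_center_iff.mp hx (y : S ⧸ K)).symm
    have h2 := (hK _).mp (QuotientGroup.eq.mp h1) w hw
    rw [map_mul, MulAut.mul_apply, map_inv, MulAut.inv_apply, MulEquiv.symm_apply_eq] at h2
    simpa using h2.symm
  let C := W ⊓ fixedBy φ x
  let ψ : V →* V := (φ x).toMonoidHom / MonoidHom.id V
  have hψ : ∀ v, ψ v = φ x v / v := fun v => rfl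
  have hker : ψ.ker = fixedBy φ x := by
    ext v
    rw [MonoidHom.mem_ker, hψ, div_eq_one, mem_fixedBy]
  let D := W.map ψ
  have hDW : D ≤ W := by
    rintro _ ⟨w, hw, rfl⟩
    exact div_mem (hW x w hw) hw
  have hCD : Nat.card C * Nat.card D = Nat.card W := by
    rw [← card_inf_mul_relIndex W ψ.ker, Subgroup.relIndex_ker, hker]
  have hCW : C ≠ W := fun h => hxK ((hK x).mpr fun w hw => (h.ge hw).2)
  have hCinv : ∀ y, ∀ w ∈ C, φ y w ∈ C := fun y w hw =>
    ⟨hW y w hw.1, mem_fixedBy.mpr (by rw [hcomm y w hw.1, mem_fixedBy.mp hw.2])⟩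
  have hCpos : 0 < Nat.card C := Nat.card_pos
  have hDpos : 0 < Nat.card D := Nat.card_pos
  by_cases hC : C = ⊥
  · have hle : ∀ y, Nat.card (W ⊓ fixedBy φ y : Subgroup V) *
        Nat.card (W ⊓ fixedBy φ (y * x) : Subgroup V) ≤ Nat.card W := by
      intro y
      refine card_mul_card_le_of_inf_eq_bot inf_le_left inf_le_left ?_
      rw [eq_bot_iff, ← hC]
      rintro w ⟨⟨hw, hy⟩, -, hyx⟩
      refine ⟨hw, mem_fixedBy.mpr ((φ y).injective ?_)⟩
      have := mem_fixedBy.mp hyx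
      rw [map_mul, MulAut.mul_apply] at this
      exact this.trans (mem_fixedBy.mp hy).symm
    calc _ = ∏ y : S, Nat.card (W ⊓ fixedBy φ y : Subgroup V) *
          Nat.card (W ⊓ fixedBy φ (y * x) : Subgroup V) := by
          rw [Finset.prod_mul_distrib, sq]
          congr 1
          exact (Equiv.prod_comp (Equiv.mulRight x)
            fun y => Nat.card (W ⊓ fixedBy φ y : Subgroup V)).symm
      _ ≤ ∏ _y : S, Nat.card W := Finset.prod_le_prod' fun y _ => hle y
      _ = _ := by simp
  · have hC1 : 1 < Nat.card C := (Subgroup.one_lt_card_iff_ne_bot C).mpr hC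
    have hClt : Nat.card C < n := by
      rw [← hn]
      refine lt_of_le_of_ne (Subgroup.card_le_of_le inf_le_left) fun h => hCW ?_
      exact Subgroup.eq_of_le_of_card_ge inf_le_left h.ge
    have hDlt : Nat.card D < n := by
      rw [← hn, ← hCD]
      exact lt_mul_of_one_lt_left hDpos hC1
    have h1 := ih _ hClt C rfl hCinv fun w hw => hfix w hw.1
    have h2 := ih _ hDlt D rfl (by
      rintro y _ ⟨w, hw, rfl⟩
      refine ⟨φ y w, hW y w hw, ?_⟩
      rw [hψ, hψ, map_div, hcomm y w hw]) fun w hw => hfix w (hDW hw)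
    have hle : ∀ y, Nat.card (W ⊓ fixedBy φ y : Subgroup V) ≤
        Nat.card (C ⊓ fixedBy φ y : Subgroup V) * Nat.card (D ⊓ fixedBy φ y : Subgroup V) := by
      intro y
      rw [← card_inf_mul_relIndex (W ⊓ fixedBy φ y) ψ.ker, Subgroup.relIndex_ker, hker,
        inf_right_comm]
      refine Nat.mul_le_mul_left _ (Subgroup.card_le_of_le ?_)
      rintro _ ⟨w, ⟨hw, hy⟩, rfl⟩
      refine ⟨⟨w, hw, rfl⟩, mem_fixedBy.mpr ?_⟩
      rw [hψ, map_div, ← hcomm y w hw, mem_fixedBy.mp hy]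
    calc _ ≤ (∏ y : S, Nat.card (C ⊓ fixedBy φ y : Subgroup V) *
          Nat.card (D ⊓ fixedBy φ y : Subgroup V)) ^ 2 :=
          Nat.pow_le_pow_left (Finset.prod_le_prod' fun y _ => hle y) 2
      _ ≤ _ := by
          rw [Finset.prod_mul_distrib, mul_pow, ← hCD, mul_pow]
          exact Nat.mul_le_mul h1 h2

/-- An `s`-group acting without nontrivial fixed points on a finite abelian group `V` contains an
element with at most `√|V|` fixed points. -/
lemma exists_card_fixedBy_sq_le [Finite S] [Finite V] {s : ℕ} [Fact s.Prime] (hS : IsPGroup s S)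
    (φ : S →* MulAut V) (hfix : ∀ v, (∀ x, φ x v = v) → v = 1) :
    ∃ x, Nat.card (fixedBy φ x) ^ 2 ≤ Nat.card V := by
  have := Fintype.ofFinite S
  by_contra! h
  have h1 := prod_card_fixedBy_sq_le hS φ _ ⊤ rfl (fun _ _ _ => Subgroup.mem_top _)
    fun v _ => hfix v
  simp only [top_inf_eq, Subgroup.card_top] at h1
  refine absurd h1 (not_le.mpr ?_)
  rw [← Finset.prod_pow]
  calc _ = ∏ _x : S, Nat.card V := by simp
    _ < _ := Finset.prod_lt_prod_of_nonempty (fun _ _ => Nat.card_pos) (fun x _ => h x)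
      Finset.univ_nonempty

end FixedPoints

section Descent

open scoped commutatorElement

variable {G V : Type*} [Group G] [AddCommGroup V] [Module ℂ V] {ρ : Representation ℂ G V}

lemma finrank_intertwiningMap_eq_one [Nontrivial V] (hs : ScalarCommutant ρ ⊤) :
    Module.finrank ℂ (Representation.IntertwiningMap ρ ρ) = 1 := by
  obtain ⟨v, hv⟩ := exists_ne (0 : V)
  have h0 : Representation.IntertwiningMap.id ρ ≠ 0 := fun h => hv <| by
    simpa using DFunLike.congr_fun h v
  refine (finrank_eq_one_iff_of_nonzero' _ h0).mpr fun f => ?_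
  obtain ⟨c, hc⟩ := hs f.toLinearMap fun g _ => f.isIntertwining' g
  refine ⟨c, Representation.IntertwiningMap.ext ?_⟩
  rw [hc]
  rfl

lemma exists_smul_one_of_mem_center (hs : ScalarCommutant ρ ⊤) {z : G}
    (hz : z ∈ Subgroup.center G) : ∃ c : ℂ, ρ z = c • 1 :=
  hs (ρ z) fun g _ => by rw [← map_mul, ← map_mul, Subgroup.mem_center_iff.mp hz g]

lemma mem_center_of_smul_one (hinj : Function.Injective ρ) {z : G} {c : ℂ}
    (hz : ρ z = c • 1) : z ∈ Subgroup.center G :=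
  Subgroup.mem_center_iff.mpr fun g => hinj (by
    rw [map_mul, map_mul, hz, mul_smul_comm, smul_mul_assoc, mul_one, one_mul])

/-- The degree of a faithful irreducible representation of a group of class at most two. -/
lemma finrank_sq_mul_card_center [Finite G] [FiniteDimensional ℂ V] [Nontrivial V]
    (hs : ScalarCommutant ρ ⊤) (hinj : Function.Injective ρ)
    (hG : ∀ x y : G, ⁅x, y⁆ ∈ Subgroup.center G) :
    Module.finrank ℂ V ^ 2 * Nat.card (Subgroup.center G) = Nat.card G := by
  have := Fintype.ofFinite G
  have hG0 : (Nat.card G : ℂ) ≠ 0 := by exact_mod_cast Nat.card_pos.ne'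
  have hzero : ∀ x ∉ Subgroup.center G, ρ.character x = 0 := by
    intro x hx
    obtain ⟨y, hy⟩ : ∃ y : G, ⁅y, x⁆ ≠ 1 := by
      by_contra! h
      exact hx (Subgroup.mem_center_iff.mpr fun g => commutatorElement_eq_one_iff_mul_comm.mp (h g))
    obtain ⟨c, hc⟩ := exists_smul_one_of_mem_center hs (hG y x)
    have hc1 : c ≠ 1 := by
      rintro rfl
      exact hy (hinj (by rw [hc, one_smul, map_one]))
    have h1 := ρ.char_conj x y
    have h2 : y * x * y⁻¹ = ⁅y, x⁆ * x := by simp [commutatorElement_def]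
    rw [h2, Representation.character, map_mul, hc, smul_mul_assoc, one_mul, map_smul,
      smul_eq_mul] at h1
    have h3 : (c - 1) * ρ.character x = 0 := by
      rw [sub_mul, one_mul, sub_eq_zero]
      exact h1
    exact (mul_eq_zero.mp h3).resolve_left (sub_ne_zero.mpr hc1)
  have hcen : ∀ x ∈ Subgroup.center G,
      ρ.character x * ρ.character x⁻¹ = (Module.finrank ℂ V : ℂ) ^ 2 := by
    intro x hx
    obtain ⟨c, hc⟩ := exists_smul_one_of_mem_center hs hx
    obtain ⟨c', hc'⟩ := exists_smul_one_of_mem_center hs (inv_mem hx)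
    have h1 : (c * c') • (1 : V →ₗ[ℂ] V) = 1 := by
      calc _ = ρ x * ρ x⁻¹ := by rw [hc, hc', smul_mul_smul_comm, mul_one]
        _ = 1 := by rw [← map_mul, mul_inv_cancel, map_one]
    have h2 : c * c' = 1 := by
      have h3 : (c * c' - 1) • (1 : V →ₗ[ℂ] V) = 0 := by rw [sub_smul, h1, one_smul, sub_self]
      exact sub_eq_zero.mp ((smul_eq_zero.mp h3).resolve_right one_ne_zero)
    rw [Representation.character, Representation.character, hc, hc', map_smul, map_smul,
      LinearMap.trace_one, smul_eq_mul, smul_eq_mul, mul_mul_mul_comm, h2, one_mul, sq]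
  let _ : Invertible (Nat.card G : ℂ) := invertibleOfNonzero hG0
  have h := Representation.card_inv_mul_sum_char_mul_char_eq_finrank ρ ρ
  rw [finrank_intertwiningMap_eq_one hs, inv_mul_eq_iff_eq_mul₀ hG0, Nat.cast_one, mul_one,
    ← Finset.sum_filter_add_sum_filter_not _ (· ∈ Subgroup.center G),
    Finset.sum_congr rfl fun x hx => hcen x (Finset.mem_filter.mp hx).2,
    Finset.sum_eq_zero (s := Finset.univ.filter (· ∉ Subgroup.center G)) fun x hx => by
      rw [hzero x (Finset.mem_filter.mp hx).2, zero_mul], add_zero, Finset.sum_const,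
    nsmul_eq_mul] at h
  have hcard : (Finset.univ.filter (· ∈ Subgroup.center G)).card =
      Nat.card (Subgroup.center G) := by
    rw [Nat.card_eq_fintype_card, Fintype.card_subtype]
  rw [hcard] at h
  rw [mul_comm]
  exact_mod_cast h

/-- The restriction of `ρ` to a normal subgroup of class two has homogeneous constituents of
dimension `d` with `d ^ 2` dividing the order of the subgroup. -/
lemma sq_dvd_card_of_groupSpan_equiv [Finite G] (hinj : Function.Injective ρ) (R : Subgroup G)
    (hR : ⁅R, R⁆ ≤ Subgroup.center G) {d : ℕ} (hd : d ≠ 0)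
    (e : groupSpan ρ R ≃ₐ[ℂ] Matrix (Fin d) (Fin d) ℂ) : d ^ 2 ∣ Nat.card R := by
  have : NeZero d := ⟨hd⟩
  let L : groupSpan ρ R ≃ₐ[ℂ] Module.End ℂ (Fin d → ℂ) := e.trans Matrix.toLinAlgEquiv'
  let σ : Representation ℂ R (Fin d → ℂ) :=
    { toFun := fun x => L ⟨ρ x, mem_groupSpan ρ x.2⟩
      map_one' := by
        rw [← map_one L]
        exact congrArg L (Subtype.ext (by simp))
      map_mul' := fun x y => by
        rw [← map_mul L]
        exact congrArg L (Subtype.ext (by simp)) }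
  have hσ : ∀ x : R, σ x = L ⟨ρ x, mem_groupSpan ρ x.2⟩ := fun x => rfl
  have hσinj : Function.Injective σ := fun x y hxy =>
    Subtype.ext (hinj (congrArg Subtype.val (L.injective hxy)))
  have hσs : ScalarCommutant σ ⊤ := by
    intro T hT
    obtain ⟨a, rfl⟩ := L.surjective T
    obtain ⟨c, hc⟩ := exists_smul_one_of_central e a.2 fun A hA =>
      commute_of_mem_groupSpan ρ R (fun x hx => by
        have h1 := hT ⟨x, hx⟩ (Subgroup.mem_top _)
        rw [hσ, ← map_mul, ← map_mul] at h1
        exact congrArg Subtype.val (L.injective h1)) hA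
    refine ⟨c, ?_⟩
    rw [show a = c • (1 : groupSpan ρ R) from Subtype.ext hc, map_smul, map_one]
  have h := finrank_sq_mul_card_center hσs hσinj fun x y => by
    rw [Subgroup.mem_center_iff]
    intro g
    refine Subtype.ext ?_
    exact Subgroup.mem_center_iff.mp
      (hR (Subgroup.commutator_mem_commutator x.2 y.2)) (g : G)
  rw [Module.finrank_fin_fun] at h
  exact ⟨_, h.symm⟩

variable [Finite G] [FiniteDimensional ℂ V] [Nontrivial V]

lemma le_center_of_commutator_eq_bot (hρ : NoImprimitivity ρ) (hinj : Function.Injective ρ)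
    (N : Subgroup G) (hN : N.Normal) (hc : ⁅N, N⁆ = ⊥) : N ≤ Subgroup.center G := by
  intro x hx
  obtain ⟨d, -, ⟨e⟩⟩ := exists_groupSpan_algEquiv_matrix hρ N
  have hcomm : ∀ y ∈ N, x * y = y * x := fun y hy =>
    (Subgroup.mem_centralizer_iff.mp
      ((Subgroup.commutator_eq_bot_iff_le_centralizer.mp hc) hx) y hy).symm
  obtain ⟨c, hc⟩ := exists_smul_one_of_central e (mem_groupSpan ρ hx) fun A hA =>
    commute_of_mem_groupSpan ρ N (fun y hy => by rw [← map_mul, ← map_mul, hcomm y hy]) hA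
  exact mem_center_of_smul_one hinj hc

/-- Descent of irreducibility of restrictions for quasi-primitive representations. -/
lemma ScalarCommutant.descend (hρ : NoImprimitivity ρ) {N : Subgroup G}
    (hN : ScalarCommutant ρ N) (K : Subgroup G) [K.Normal] (U : Set G)
    (hU : N ≤ K ⊔ Subgroup.closure U)
    (hc : U.Subsingleton ∨ (∀ u ∈ U, ∀ v ∈ U, u * v = v * u) ∧
      ∃ k : ℕ, (∀ d, Nonempty (groupSpan ρ K ≃ₐ[ℂ] Matrix (Fin d) (Fin d) ℂ) → k.Coprime d) ∧
        ∀ u ∈ U, u ^ k = 1) : ScalarCommutant ρ K := by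
  obtain ⟨d, -, ⟨e⟩⟩ := exists_groupSpan_algEquiv_matrix hρ K
  let f : G →* (V →ₗ[ℂ] V)ˣ := MonoidHom.toHomUnits ρ
  have hf : ∀ g, (f g : V →ₗ[ℂ] V) = ρ g := fun g => rfl
  have hf' : ∀ g, (↑(f g)⁻¹ : V →ₗ[ℂ] V) = ρ g⁻¹ := fun g => by rw [← map_inv, hf]
  have hscalar : ∀ T : V →ₗ[ℂ] V, (∀ n ∈ K, T * ρ n = ρ n * T) →
      (∀ u ∈ U, T * ρ u = ρ u * T) → ∃ c : ℂ, T = c • 1 := by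
    intro T hTK hTU
    refine hN T fun n hn => ?_
    let C : Subgroup G :=
      { carrier := {g | T * ρ g = ρ g * T}
        mul_mem' := fun {a b} ha hb => by
          have ha : T * ρ a = ρ a * T := ha
          have hb : T * ρ b = ρ b * T := hb
          change T * ρ (a * b) = ρ (a * b) * T
          rw [map_mul, ← mul_assoc, ha, mul_assoc, hb, mul_assoc]
        one_mem' := by
          change T * ρ 1 = ρ 1 * T
          rw [map_one, mul_one, one_mul]
        inv_mem' := fun {a} ha => by
          have h1 : Commute T (f a : V →ₗ[ℂ] V) := ha
          have h2 := h1.units_inv_right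
          rw [hf'] at h2
          exact h2 }
    have hle : K ⊔ Subgroup.closure U ≤ C :=
      sup_le hTK ((Subgroup.closure_le C).mpr hTU)
    exact hle (hU hn)
  have hmem : ∀ u ∈ f '' U, (u : V →ₗ[ℂ] V) ∈ groupSpan ρ K := by
    refine units_subset_of_scalar_commutant e (f '' U) ?_ ?_ ?_
    · rintro _ ⟨u, -, rfl⟩ A hA
      rw [hf, hf']
      exact conj_mem_groupSpan ρ K u hA
    · intro T hTA hTU
      exact hscalar T (fun n hn => hTA _ (mem_groupSpan ρ hn)) fun u hu => hTU _ ⟨u, hu, rfl⟩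
    · refine hc.imp (fun h => h.image f) ?_
      rintro ⟨h1, k, hk, h2⟩
      refine ⟨?_, k, hk d ⟨e⟩, ?_⟩
      · rintro _ ⟨u, hu, rfl⟩ _ ⟨v, hv, rfl⟩
        rw [← map_mul, ← map_mul, h1 u hu v hv]
      · rintro _ ⟨u, hu, rfl⟩
        rw [← map_pow, h2 u hu, map_one]
  exact fun T hT => hscalar T hT fun u hu =>
    commute_of_mem_groupSpan ρ K hT (hmem _ ⟨u, hu, rfl⟩)

lemma ScalarCommutant.of_index_eq_pow (hρ : NoImprimitivity ρ) (hs : ScalarCommutant ρ ⊤)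
    {r : ℕ} [Fact r.Prime] (n : ℕ) : ∀ Y : Subgroup G, Y.Normal → Y.index = n →
      (∃ k, n = r ^ k) → ScalarCommutant ρ Y := by
  induction n using Nat.strong_induction_on with
  | _ n ih =>
  rintro Y hY hYn ⟨k, hk⟩
  by_cases htop : Y = ⊤
  · rwa [htop]
  have : Nontrivial (G ⧸ Y) := QuotientGroup.nontrivial_iff.mpr htop
  have hr : IsPGroup r (G ⧸ Y) := IsPGroup.of_card (n := k) (by
    rw [← hk, ← hYn, Subgroup.index_eq_card])
  obtain ⟨z, hz, hz1⟩ := (Subgroup.nontrivial_iff_exists_ne_one _).mp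
    (Subgroup.nontrivial_iff_ne_bot _ |>.mpr hr.bot_lt_center.ne')
  obtain ⟨m, rfl⟩ := QuotientGroup.mk_surjective z
  let Z : Subgroup (G ⧸ Y) := Subgroup.zpowers (m : G ⧸ Y)
  have hZ : Z.Normal := by
    refine ⟨fun x hx g => ?_⟩
    have hxc : x ∈ Subgroup.center (G ⧸ Y) := (Subgroup.zpowers_le.mpr hz) hx
    rwa [Subgroup.mem_center_iff.mp hxc g, mul_inv_cancel_right]
  let Y' : Subgroup G := Z.comap (QuotientGroup.mk' Y)
  have hYY' : Y < Y' := by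
    refine lt_of_le_of_ne (fun y hy => ?_) fun h => hz1 ?_
    · rw [Subgroup.mem_comap, QuotientGroup.mk'_apply, (QuotientGroup.eq_one_iff y).mpr hy]
      exact one_mem _
    · refine (QuotientGroup.eq_one_iff m).mpr (h ▸ ?_)
      exact Subgroup.mem_zpowers (m : G ⧸ Y)
  have hdvd : Y'.index ∣ n := hYn ▸ Subgroup.index_dvd_of_le hYY'.le
  have hlt : Y'.index < n := by
    refine lt_of_le_of_ne (Nat.le_of_dvd (hYn ▸ Nat.pos_of_ne_zero Subgroup.index_ne_zero_of_finite)
      hdvd) fun h => hYY'.ne ?_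
    refine Subgroup.eq_of_le_of_card_ge hYY'.le ?_
    have h1 := Y.card_mul_index
    rw [hYn, ← h, ← Y'.card_mul_index] at h1
    exact (Nat.eq_of_mul_eq_mul_right (Nat.pos_of_ne_zero Subgroup.index_ne_zero_of_finite) h1).ge
  have hind := ih _ hlt Y' inferInstance rfl (by
    obtain ⟨j, -, hj⟩ := (Nat.dvd_prime_pow Fact.out).mp (hk ▸ hdvd)
    exact ⟨j, hj⟩)
  refine hind.descend hρ Y {m} (fun y hy => ?_) (Or.inl Set.subsingleton_singleton)
  obtain ⟨i, hi⟩ := Subgroup.mem_zpowers_iff.mp (show (y : G ⧸ Y) ∈ Z from hy)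
  have h1 : y * (m ^ i)⁻¹ ∈ Y := by
    rw [← QuotientGroup.eq_one_iff, QuotientGroup.mk_mul, QuotientGroup.mk_inv, ← hi,
      QuotientGroup.mk_zpow, mul_inv_cancel]
  have hm : m ∈ Subgroup.closure {m} := Subgroup.subset_closure (Set.mem_singleton m)
  have h2 : y * (m ^ i)⁻¹ * m ^ i ∈ Y ⊔ Subgroup.closure {m} :=
    Subgroup.mul_mem _ (Subgroup.mem_sup_left h1)
      (Subgroup.mem_sup_right (Subgroup.zpow_mem _ hm i))
  rwa [inv_mul_cancel_right] at h2

end Descent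

section Faithful

open scoped commutatorElement

variable {G V : Type*} [Group G] [AddCommGroup V] [Module ℂ V] {ρ : Representation ℂ G V}
  [Finite G] [FiniteDimensional ℂ V] [Nontrivial V]

lemma dvd_of_sq_mul_eq {r : ℕ} (hr : r.Prime) {f z v c i m F n : ℕ} (hm : m = r ^ n)
    (h1 : f ^ 2 * z = m) (h2 : z * v = m) (h3 : c * i = m) (h4 : c ≤ z * F) (h5 : F ^ 2 ≤ v) :
    f ∣ i := by
  have hm0 : 0 < m := hm ▸ pow_pos hr.pos n
  have hc0 : 0 < c := Nat.pos_of_ne_zero (by rintro rfl; simp at h3; omega)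
  have h6 : c ^ 2 ≤ z * m := by
    calc c ^ 2 ≤ (z * F) ^ 2 := Nat.pow_le_pow_left h4 2
      _ = z ^ 2 * F ^ 2 := mul_pow _ _ _
      _ ≤ z ^ 2 * v := Nat.mul_le_mul_left _ h5
      _ = z * m := by rw [← h2]; ring
  have h7 : c ^ 2 * f ^ 2 ≤ c ^ 2 * i ^ 2 := by
    calc c ^ 2 * f ^ 2 ≤ z * m * f ^ 2 := Nat.mul_le_mul_right _ h6
      _ = m * (f ^ 2 * z) := by ring
      _ = (c * i) * (c * i) := by rw [h1, h3]
      _ = c ^ 2 * i ^ 2 := by ring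
  have h8 : f ≤ i :=
    (Nat.pow_le_pow_iff_left two_ne_zero).mp (Nat.le_of_mul_le_mul_left h7 (pow_pos hc0 2))
  obtain ⟨a, -, rfl⟩ := (Nat.dvd_prime_pow hr).mp
    (hm ▸ (h1 ▸ (dvd_pow_self f two_ne_zero).mul_right z) : f ∣ r ^ n)
  obtain ⟨b, -, rfl⟩ := (Nat.dvd_prime_pow hr).mp (hm ▸ (h3 ▸ dvd_mul_left i c) : i ∣ r ^ n)
  exact pow_dvd_pow r ((Nat.pow_le_pow_iff_right hr.one_lt).mp h8)

lemma sup_eq_top_of_index_eq_pow {r k : ℕ} [Fact r.Prime] (T : Sylow r G) (Y : Subgroup G)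
    (hY : Y.index = r ^ k) : (T : Subgroup G) ⊔ Y = ⊤ := by
  rw [← Subgroup.index_eq_one]
  have h1 : ((T : Subgroup G) ⊔ Y).index ∣ r ^ k := hY ▸ Subgroup.index_dvd_of_le le_sup_right
  have h2 : ((T : Subgroup G) ⊔ Y).index ∣ (T : Subgroup G).index :=
    Subgroup.index_dvd_of_le le_sup_left
  obtain ⟨j, -, hj⟩ := (Nat.dvd_prime_pow Fact.out).mp h1
  rcases Nat.eq_zero_or_pos j with rfl | hj0
  · simpa using hj
  · exact absurd ((dvd_pow_self r hj0.ne').trans (hj ▸ h2)) T.not_dvd_index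

lemma scalarCommutant_of_sup {r s : ℕ} [Fact r.Prime] [Fact s.Prime] (hrs : r ≠ s)
    (hρ : NoImprimitivity ρ) (hs : ScalarCommutant ρ ⊤) (hinj : Function.Injective ρ)
    (R X : Subgroup G) [R.Normal] (hR : IsPGroup r R) (hX : IsPGroup s X)
    (hRc : ⁅R, R⁆ ≤ Subgroup.center G) (hY : (R ⊔ X).Normal)
    (hidx : ∃ k, (R ⊔ X).index = r ^ k)
    (hXc : (∀ x ∈ X, ∀ y ∈ X, x * y = y * x) ∨ R ⊔ X = ⊤) : ScalarCommutant ρ R := by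
  obtain ⟨n, hn⟩ := IsPGroup.iff_card.mp hX
  obtain ⟨m, hm⟩ := IsPGroup.iff_card.mp hR
  rcases hXc with hXc | htop
  · refine (ScalarCommutant.of_index_eq_pow hρ hs _ (R ⊔ X) hY rfl hidx).descend hρ R X
      (by rw [Subgroup.closure_eq]) (Or.inr ⟨hXc, Nat.card X, ?_, ?_⟩)
    · rintro d ⟨e⟩
      rcases eq_or_ne d 0 with rfl | hd
      · have : Subsingleton (groupSpan ρ R) := e.injective.subsingleton
        exact absurd (congrArg Subtype.val (Subsingleton.elim (1 : groupSpan ρ R) 0)) one_ne_zero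
      · have h1 := sq_dvd_card_of_groupSpan_equiv hinj R hRc hd e
        rw [hn]
        refine Nat.Coprime.coprime_dvd_right ((dvd_pow_self d two_ne_zero).trans (hm ▸ h1)) ?_
        exact Nat.Coprime.pow _ _ ((Nat.coprime_primes Fact.out Fact.out).mpr hrs.symm)
    · intro u hu
      exact congrArg Subtype.val (pow_card_eq_one' (x := (⟨u, hu⟩ : X)))
  · refine ScalarCommutant.of_index_eq_pow (r := s) hρ hs _ R inferInstance rfl ?_
    have h1 : R.index ∣ s ^ n := by
      rw [← hn, ← Subgroup.relIndex_top_right, ← htop, sup_comm, Subgroup.relIndex_sup_right]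
      exact Subgroup.relIndex_dvd_card _ _
    obtain ⟨j, -, hj⟩ := (Nat.dvd_prime_pow Fact.out).mp h1
    exact ⟨j, hj⟩

lemma finrank_dvd_classSize_of_injective {r s : ℕ} [Fact r.Prime] [Fact s.Prime] (hrs : r ≠ s)
    (hρ : NoImprimitivity ρ) (hs : ScalarCommutant ρ ⊤) (hinj : Function.Injective ρ)
    (R X : Subgroup G) [R.Normal] (hR : IsPGroup r R) (hX : IsPGroup s X)
    (hY : (R ⊔ X).Normal) (hidx : ∃ k, (R ⊔ X).index = r ^ k)
    (hXc : (∀ x ∈ X, ∀ y ∈ X, x * y = y * x) ∨ R ⊔ X = ⊤) :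
    ∃ g : G, Module.finrank ℂ V ∣ classSize g := by
  have hG := le_center_of_commutator_eq_bot hρ hinj
  have hRc := commutator_le_center_of_abelian_normal hG R hR
  have hRs := scalarCommutant_of_sup hrs hρ hs hinj R X hR hX hRc hY hidx hXc
  obtain ⟨m, hm⟩ := IsPGroup.iff_card.mp hR
  let Z := Subgroup.center G
  let π := QuotientGroup.mk' Z
  have hmk : ∀ g w : G, ⁅g, w⁆ ∈ Z ↔ π g * π w * (π g)⁻¹ = π w := by
    intro g w
    rw [← QuotientGroup.eq_one_iff, ← mul_inv_eq_one (a := π g * π w * (π g)⁻¹)]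
    rfl
  have hfin : Module.finrank ℂ V ^ 2 * Nat.card (R ⊓ Z : Subgroup G) = Nat.card R := by
    let σ : Representation ℂ R V := ρ.comp R.subtype
    have hσs : ScalarCommutant σ ⊤ := fun T hT =>
      hRs T fun n hn => hT ⟨n, hn⟩ (Subgroup.mem_top _)
    rw [← finrank_sq_mul_card_center hσs (hinj.comp Subtype.val_injective) fun x y =>
      Subgroup.mem_center_iff.mpr fun g => Subtype.ext
        (Subgroup.mem_center_iff.mp (hRc (Subgroup.commutator_mem_commutator x.2 y.2)) (g : G))]
    congr 1
    have h1 : (Subgroup.center R).map R.subtype = R ⊓ Z := by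
      ext z
      constructor
      · rintro ⟨z, hz, rfl⟩
        obtain ⟨c, hc⟩ := exists_smul_one_of_mem_center hσs hz
        exact ⟨z.2, mem_center_of_smul_one hinj hc⟩
      · rintro ⟨hzR, hz⟩
        exact ⟨⟨z, hzR⟩, Subgroup.mem_center_iff.mpr fun g => Subtype.ext
          (Subgroup.mem_center_iff.mp hz g), rfl⟩
    rw [← h1, Subgroup.card_subtype]
  let W : Subgroup (G ⧸ Z) := R.map π
  have hWn : W.Normal := Subgroup.Normal.map inferInstance _ (QuotientGroup.mk'_surjective Z)
  have hcardW : Nat.card (R ⊓ Z : Subgroup G) * Nat.card W = Nat.card R := by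
    rw [← card_inf_mul_relIndex R π.ker, Subgroup.relIndex_ker, QuotientGroup.ker_mk']
  let instW : CommGroup W :=
    { (inferInstance : Group W) with
      mul_comm := by
        rintro ⟨_, x, hx, rfl⟩ ⟨_, y, hy, rfl⟩
        refine Subtype.ext ?_
        exact mul_inv_eq_iff_eq_mul.mp
          ((hmk x y).mp (hRc (Subgroup.commutator_mem_commutator hx hy))) |>.trans rfl }
  let φ : X →* MulAut W := (MulAut.conjNormal (H := W)).comp (π.comp X.subtype)
  have hφ : ∀ (x : X) (v : W), ((φ x v : W) : G ⧸ Z) = π x * v * (π x)⁻¹ := fun x v => rfl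
  have hfix : ∀ v, (∀ x, φ x v = v) → v = 1 := by
    rintro ⟨_, w, hw, rfl⟩ hv
    obtain ⟨T, hRT⟩ := hR.exists_le_sylow
    obtain ⟨k, hk⟩ := hidx
    have hle : R ⊔ X ≤ (Subgroup.centralizer {π w}).comap π := by
      refine sup_le (fun y hy => ?_) (fun y hy => ?_) <;>
        rw [Subgroup.mem_comap, Subgroup.mem_centralizer_singleton_iff, ← mul_inv_eq_iff_eq_mul]
      · exact (hmk y w).mp (hRc (Subgroup.commutator_mem_commutator hy hw))
      · exact congrArg Subtype.val (hv ⟨y, hy⟩)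
    have hwZ := mem_center_of_commutator_mem_center_of_sup_eq_top hG R T (R ⊔ X) T.isPGroup' hRT
      (sup_eq_top_of_index_eq_pow T _ hk) hw fun y hy => (hmk y w).mpr (by
        rw [mul_inv_eq_iff_eq_mul]
        exact Subgroup.mem_centralizer_singleton_iff.mp (hle hy))
    exact Subtype.ext ((QuotientGroup.eq_one_iff w).mpr hwZ)
  obtain ⟨x, hx⟩ := exists_card_fixedBy_sq_le hX φ hfix
  refine ⟨x, (dvd_of_sq_mul_eq (Fact.out : r.Prime) hm hfin hcardW
    (card_inf_mul_relIndex R (Subgroup.centralizer {(x : G)})) ?_ hx).trans ?_⟩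
  · rw [← card_inf_mul_relIndex (R ⊓ Subgroup.centralizer {(x : G)}) π.ker, Subgroup.relIndex_ker,
      QuotientGroup.ker_mk']
    refine Nat.mul_le_mul (Subgroup.card_le_of_le (inf_le_inf_right _ inf_le_left)) ?_
    rw [← Subgroup.card_subtype W (fixedBy φ x)]
    refine Subgroup.card_le_of_le ?_
    rintro _ ⟨g, ⟨hgR, hg⟩, rfl⟩
    refine ⟨⟨π g, g, hgR, rfl⟩, mem_fixedBy.mpr (Subtype.ext ?_), rfl⟩
    rw [hφ, mul_inv_eq_iff_eq_mul]
    change π x * π g = π g * π x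
    rw [← map_mul, ← map_mul]
    exact congrArg π (Subgroup.mem_centralizer_singleton_iff.mp hg).symm
  · rw [classSize_eq_index_centralizer]
    exact relIndex_dvd_index_of_normal_right _ _

end Faithful

lemma isIntegral_sum_of_pow_eq_one {n : ℕ} (hn : 0 < n) (s : Multiset ℂ)
    (hs : ∀ z ∈ s, z ^ n = 1) : IsIntegral ℤ s.sum :=
  IsIntegral.multiset_sum fun z hz ↦
    IsIntegral.of_pow hn (by rw [hs z hz]; exact isIntegral_one)

/-- A mean of roots of unity that is an algebraic integer is zero, unless all the roots of unity
involved coincide. -/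
lemma sum_eq_zero_or_forall_eq_of_isIntegral_div {n : ℕ} (hn : 0 < n) (s : Multiset ℂ)
    (hs : ∀ z ∈ s, z ^ n = 1) (hint : IsIntegral ℤ (s.sum / s.card)) :
    s.sum = 0 ∨ ∀ z ∈ s, z = s.sum / s.card := by
  by_cases h0 : s.sum = 0
  · exact .inl h0
  right
  have hcard : 0 < s.card := by
    rw [Multiset.card_pos]; rintro rfl; simp at h0
  have hcardC : (s.card : ℂ) ≠ 0 := by exact_mod_cast hcard.ne'
  set w : ℂ := s.sum / s.card with hw
  have hwsum : s.sum = s.card * w := by rw [hw]; field_simp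
  have hnorm : ∀ z ∈ s, ‖z‖ = 1 := fun z hz ↦
    Complex.norm_eq_one_of_pow_eq_one (hs z hz) hn.ne'
  have hw1 : ‖w‖ = 1 := by
    let K := IntermediateField.adjoin ℚ {z : ℂ | z ^ n = 1}
    have hfin : {z : ℂ | z ^ n = 1}.Finite := by
      refine (Polynomial.nthRootsFinset n (1 : ℂ)).finite_toSet.subset fun z hz ↦ ?_
      simpa [Polynomial.mem_nthRootsFinset hn] using hz
    have : Finite {z : ℂ | z ^ n = 1} := hfin
    have : FiniteDimensional ℚ K := IntermediateField.finiteDimensional_adjoin fun z hz ↦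
      IsIntegral.of_pow hn (by rw [show z ^ n = 1 from hz]; exact isIntegral_one)
    let : NumberField K := { to_charZero := K.charZero, to_finiteDimensional := this }
    obtain ⟨t, rfl⟩ : ∃ t : Multiset K, t.map (algebraMap K ℂ) = s := by
      have hsK : ∀ z ∈ s, ∃ y : K, algebraMap K ℂ y = z := fun z hz ↦
        ⟨⟨z, IntermediateField.subset_adjoin ℚ _ (hs z hz)⟩, rfl⟩
      choose! f hf using hsK
      refine ⟨s.map f, ?_⟩
      rw [Multiset.map_map]
      exact (Multiset.map_congr rfl hf).trans s.map_id
    have ht : ∀ y ∈ t, y ^ n = 1 := fun y hy ↦ by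
      apply (algebraMap K ℂ).injective
      rw [map_pow, map_one]
      exact hs _ (Multiset.mem_map_of_mem _ hy)
    set y : K := t.sum / t.card with hy
    have hyw : algebraMap K ℂ y = w := by
      rw [hw, hy, map_div₀, map_natCast, Multiset.card_map, map_multiset_sum]
    have hyint : IsIntegral ℤ y := by
      rw [← isIntegral_algebraMap_iff (algebraMap K ℂ).injective, hyw]
      exact hint
    have hy0 : y ≠ 0 := by
      rintro h
      rw [h, map_zero] at hyw
      rw [hwsum, ← hyw, mul_zero] at h0
      exact h0 rfl
    obtain ⟨m, hm, hym⟩ := NumberField.Embeddings.pow_eq_one_of_norm_le_one K ℂ hy0 hyint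
      fun φ ↦ by
        have hφ : ∀ a ∈ t.map φ, ‖a‖ = 1 := fun a ha ↦ by
          obtain ⟨b, hb, rfl⟩ := Multiset.mem_map.1 ha
          exact Complex.norm_eq_one_of_pow_eq_one (by rw [← map_pow, ht b hb, map_one]) hn.ne'
        have hsum : ‖(t.map φ).sum‖ ≤ t.card := by
          refine (norm_multiset_sum_le _).trans ?_
          rw [Multiset.map_congr rfl hφ]
          simp
        have hcard' : (0 : ℝ) < t.card := by
          rw [Multiset.card_map] at hcard; exact_mod_cast hcard
        rw [hy, map_div₀, map_natCast, map_multiset_sum, norm_div, Complex.norm_natCast]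
        exact (div_le_one hcard').2 hsum
    refine Complex.norm_eq_one_of_pow_eq_one (n := m) ?_ hm.ne'
    rw [← hyw, ← map_pow, hym, map_one]
  have hle : ∀ z ∈ s, 0 ≤ 1 - ((starRingEnd ℂ) w * z).re := fun z hz ↦ by
    have := Complex.re_le_norm ((starRingEnd ℂ) w * z)
    rw [norm_mul, RCLike.norm_conj, hw1, hnorm z hz] at this
    linarith
  have hzero : (s.map fun z ↦ 1 - ((starRingEnd ℂ) w * z).re).sum = 0 := by
    have h1 : (s.map fun z ↦ ((starRingEnd ℂ) w * z).re).sum = s.card := by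
      have : (s.map fun z ↦ ((starRingEnd ℂ) w * z).re).sum = ((starRingEnd ℂ) w * s.sum).re := by
        have h2 := map_multiset_sum Complex.reAddGroupHom (s.map fun z ↦ (starRingEnd ℂ) w * z)
        rw [Multiset.sum_map_mul_left, Multiset.map_id', Multiset.map_map] at h2
        exact h2.symm
      rw [this, hwsum, mul_left_comm, ← Complex.normSq_eq_conj_mul_self, Complex.normSq_eq_norm_sq,
        hw1]
      simp
    rw [Multiset.sum_map_sub, h1]
    simp
  intro z hz
  have h1 := Multiset.all_zero_of_le_zero_le_of_sum_eq_zero (by simpa using hle) hzero _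
    (Multiset.mem_map_of_mem _ hz)
  have hre : ((starRingEnd ℂ) w * z).re = 1 := by linarith
  have hz1 : ‖(starRingEnd ℂ) w * z‖ = 1 := by
    rw [norm_mul, RCLike.norm_conj, hw1, hnorm z hz, one_mul]
  have hone : (starRingEnd ℂ) w * z = 1 := by
    have h2 := Complex.normSq_apply ((starRingEnd ℂ) w * z)
    rw [Complex.normSq_eq_norm_sq, hz1, hre] at h2
    refine Complex.ext (by simpa using hre) ?_
    simp only [Complex.one_im]
    nlinarith
  have hww : w * (starRingEnd ℂ) w = 1 := by
    rw [Complex.mul_conj, Complex.normSq_eq_norm_sq, hw1]; simp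
  calc z = w * (starRingEnd ℂ) w * z := by rw [hww, one_mul]
    _ = w := by rw [mul_assoc, hone, mul_one]

/-- A matrix of finite order with a single eigenvalue is scalar. -/
lemma eq_scalar_of_pow_eq_one {m : Type*} [Fintype m] [DecidableEq m] {n : ℕ} (hn : 0 < n)
    (M : Matrix m m ℂ) (hM : M ^ n = 1) (c : ℂ) (hc : ∀ z ∈ M.charpoly.roots, z = c) :
    M = algebraMap ℂ _ c := by
  have hsplit : M.charpoly = (Polynomial.X - Polynomial.C c) ^ M.charpoly.roots.card := by
    conv_lhs => rw [(IsAlgClosed.splits M.charpoly).eq_prod_roots_of_monic M.charpoly_monic]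
    rw [Multiset.map_congr rfl
      (g := fun _ ↦ Polynomial.X - Polynomial.C c) (fun z hz ↦ by rw [hc z hz])]
    rw [Multiset.map_const', Multiset.prod_replicate]
  have h1 : minpoly ℂ M ∣ (Polynomial.X - Polynomial.C c) ^ M.charpoly.roots.card :=
    hsplit ▸ Matrix.minpoly_dvd_charpoly M
  have h2 : minpoly ℂ M ∣ Polynomial.X ^ n - 1 := minpoly.dvd _ _ (by simp [hM])
  have hsq : Squarefree (Polynomial.X ^ n - 1 : Polynomial ℂ) :=
    ((Polynomial.X_pow_sub_one_separable_iff).2 (by exact_mod_cast hn.ne')).squarefree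
  have h3 : minpoly ℂ M ∣ Polynomial.X - Polynomial.C c :=
    (hsq.squarefree_of_dvd h2).isRadical _ _ h1
  have := Polynomial.aeval_eq_zero_of_dvd_aeval_eq_zero h3 (minpoly.aeval ℂ M)
  simpa [sub_eq_zero] using this

lemma pow_eq_one_of_mem_roots_charpoly {m : Type*} [Fintype m] [DecidableEq m] {n : ℕ}
    (M : Matrix m m ℂ) (hM : M ^ n = 1) : ∀ z ∈ M.charpoly.roots, z ^ n = 1 := by
  intro z hz
  have h1 : z ∈ spectrum ℂ M := by
    rw [Matrix.mem_spectrum_iff_isRoot_charpoly]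
    exact Polynomial.isRoot_of_mem_roots hz
  have h2 := spectrum.pow_mem_pow M n h1
  rw [hM] at h2
  by_cases hm : Nonempty m
  · simpa using h2
  · have : IsEmpty m := not_nonempty_iff.1 hm
    simp at hz

lemma trace_mulLeft_pi_matrix {n : ℕ} {d : Fin n → ℕ}
    (a : ∀ i, Matrix (Fin (d i)) (Fin (d i)) ℂ) :
    LinearMap.trace ℂ _ (LinearMap.mulLeft ℂ a) = ∑ i, (d i : ℂ) * (a i).trace := by
  let b := Pi.basis fun i ↦ Matrix.stdBasis ℂ (Fin (d i)) (Fin (d i))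
  rw [LinearMap.trace_eq_matrix_trace ℂ b, Matrix.trace]
  have hdiag : ∀ t : Σ i, Fin (d i) × Fin (d i),
      LinearMap.toMatrix b b (LinearMap.mulLeft ℂ a) t t = a t.1 t.2.1 t.2.1 := by
    rintro ⟨i, j, k⟩
    have hrepr : ∀ (M : Matrix (Fin (d i)) (Fin (d i)) ℂ),
        (Matrix.stdBasis ℂ (Fin (d i)) (Fin (d i))).repr M (j, k) = M j k := fun M ↦ by
      simp [Matrix.stdBasis]
    rw [LinearMap.toMatrix_apply, Pi.basis_repr, Pi.basis_apply, Matrix.stdBasis_eq_single, hrepr]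
    simp
  simp only [Matrix.diag_apply, hdiag]
  rw [Fintype.sum_sigma]
  refine Finset.sum_congr rfl fun i _ ↦ ?_
  rw [Fintype.sum_prod_type]
  simp [Matrix.trace, Finset.mul_sum]

lemma trace_mulLeft_single {G : Type*} [Group G] [Finite G] {x : G} (hx : x ≠ 1) :
    LinearMap.trace ℂ (MonoidAlgebra ℂ G)
      (LinearMap.mulLeft ℂ (MonoidAlgebra.single x (1 : ℂ))) = 0 := by
  have := Fintype.ofFinite G
  rw [LinearMap.trace_eq_matrix_trace ℂ (MonoidAlgebra.basis G ℂ), Matrix.trace]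
  refine Finset.sum_eq_zero fun g _ ↦ ?_
  rw [Matrix.diag_apply, LinearMap.toMatrix_apply]
  simp only [MonoidAlgebra.basis_apply, LinearMap.mulLeft_apply, MonoidAlgebra.single_mul_single,
    mul_one]
  change (MonoidAlgebra.single (x * g) (1 : ℂ)).coeff g = 0
  rw [MonoidAlgebra.coeff_single, Finsupp.single_apply, if_neg]
  simpa using hx

/-- The irreducible matrix representations of a finite group, as read off from the
Wedderburn decomposition of its group algebra. -/
lemma exists_matrix_representations (G : Type*) [Group G] [Finite G] :
    ∃ (n : ℕ) (d : Fin n → ℕ) (φ : ∀ i, G →* Matrix (Fin (d i)) (Fin (d i)) ℂ),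
      (∀ i, d i ≠ 0) ∧
      (∀ x, x ≠ 1 → ∑ i, (d i : ℂ) * (φ i x).trace = 0) ∧
      (∀ i M, (∀ g, φ i g * M = M * φ i g) → ∃ c : ℂ, M = algebraMap ℂ _ c) ∧
      ∃ i₀, d i₀ = 1 ∧ ∀ i, φ i = 1 ↔ i = i₀ := by
  have := Fintype.ofFinite G
  have : NeZero (Nat.card G : ℂ) := ⟨by exact_mod_cast Nat.card_pos.ne'⟩
  have : FiniteDimensional ℂ (MonoidAlgebra ℂ G) := .of_basis (MonoidAlgebra.basis G ℂ)
  obtain ⟨n, d, hd, ⟨e⟩⟩ :=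
    IsSemisimpleRing.exists_algEquiv_pi_matrix_of_isAlgClosed ℂ (MonoidAlgebra ℂ G)
  let π (i : Fin n) : MonoidAlgebra ℂ G →ₐ[ℂ] Matrix (Fin (d i)) (Fin (d i)) ℂ :=
    (Pi.evalAlgHom ℂ _ i).comp e.toAlgHom
  let φ (i : Fin n) : G →* Matrix (Fin (d i)) (Fin (d i)) ℂ :=
    (π i : MonoidAlgebra ℂ G →* _).comp (MonoidAlgebra.of ℂ G)
  have hφ : ∀ i g, φ i g = e (MonoidAlgebra.single g 1) i := fun _ _ ↦ rfl
  have hπsurj : ∀ i, Function.Surjective (π i) := fun i M ↦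
    ⟨e.symm (Pi.single i M), by simp [π]⟩
  have hscalar : ∀ i M, (∀ g, φ i g * M = M * φ i g) → ∃ c : ℂ, M = algebraMap ℂ _ c := by
    intro i M hM
    have hall : ∀ a, π i a * M = M * π i a := fun a ↦ by
      induction a using MonoidAlgebra.induction_on with
      | of g => exact hM g
      | add a b ha hb => rw [map_add, add_mul, mul_add, ha, hb]
      | smul r a ha => rw [map_smul, smul_mul_assoc, mul_smul_comm, ha]
    have := Matrix.mem_range_scalar_of_commute_single (M := M) fun j k _ ↦ by
      obtain ⟨a, ha⟩ := hπsurj i (Matrix.single j k 1)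
      rw [← ha]
      exact hall a
    obtain ⟨c, hc⟩ := this
    exact ⟨c, hc.symm⟩
  have htriv : ∀ i j, φ i = 1 → φ j = 1 → ∀ a, ∃ c : ℂ,
      π i a = algebraMap ℂ _ c ∧ π j a = algebraMap ℂ _ c := by
    intro i j hi hj a
    induction a using MonoidAlgebra.induction_on with
    | of g =>
      exact ⟨1, (DFunLike.congr_fun hi g).trans (map_one _).symm,
        (DFunLike.congr_fun hj g).trans (map_one _).symm⟩
    | add a b ha hb =>
      obtain ⟨r, hr, hr'⟩ := ha
      obtain ⟨s, hs, hs'⟩ := hb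
      exact ⟨r + s, by rw [map_add, map_add, hr, hs], by rw [map_add, map_add, hr', hs']⟩
    | smul r a ha =>
      obtain ⟨s, hs, hs'⟩ := ha
      exact ⟨r * s, by rw [map_smul, map_mul, hs, Algebra.smul_def],
        by rw [map_smul, map_mul, hs', Algebra.smul_def]⟩
  have hdim : ∀ i, φ i = 1 → d i = 1 := by
    intro i hi
    have : Subsingleton (Fin (d i)) := ⟨fun j k ↦ by
      by_contra hjk
      obtain ⟨a, ha⟩ := hπsurj i (Matrix.single j j 1)
      obtain ⟨c, hc, -⟩ := htriv i i hi hi a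
      rw [ha] at hc
      have h1 := congrFun (congrFun hc j) j
      have h2 := congrFun (congrFun hc k) k
      simp [Matrix.algebraMap_matrix_apply, hjk] at h1 h2
      exact one_ne_zero (h1.trans h2.symm)⟩
    have := Fin.subsingleton_iff_le_one.1 this
    have := (hd i).ne
    omega
  have huniq : ∀ i j, φ i = 1 → φ j = 1 → i = j := by
    intro i j hi hj
    by_contra hij
    set a := e.symm (Pi.single i 1) with ha
    have h1 : π i a = 1 := by simp [π, ha]
    have h2 : π j a = 0 := by simp [π, ha, Ne.symm hij]
    have := hd i; have := hd j
    obtain ⟨c, hc, hc'⟩ := htriv i j hi hj a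
    rw [hc, map_eq_one_iff _ (algebraMap ℂ _).injective] at h1
    rw [hc', h1, map_one] at h2
    exact one_ne_zero h2
  obtain ⟨i₀, hi₀⟩ : ∃ i, φ i = 1 := by
    let ε : MonoidAlgebra ℂ G := ∑ g, MonoidAlgebra.single g 1
    have hε : ε ≠ 0 := by
      intro h
      have := congrArg (fun a : MonoidAlgebra ℂ G ↦ a.coeff 1) h
      simp [ε, Finsupp.single_apply] at this
    have hl : ∀ g, MonoidAlgebra.single g 1 * ε = ε := fun g ↦ by
      simp only [ε, Finset.mul_sum, MonoidAlgebra.single_mul_single, one_mul]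
      exact (Group.mulLeft_bijective g).sum_comp (fun h ↦ MonoidAlgebra.single h (1 : ℂ))
    have hr : ∀ g, ε * MonoidAlgebra.single g 1 = ε := fun g ↦ by
      simp only [ε, Finset.sum_mul, MonoidAlgebra.single_mul_single, one_mul]
      exact (Group.mulRight_bijective g).sum_comp (fun h ↦ MonoidAlgebra.single h (1 : ℂ))
    obtain ⟨i, hi⟩ : ∃ i, π i ε ≠ 0 := by
      by_contra! h
      exact hε (e.injective (by rw [map_zero]; exact funext h))
    have hl' : ∀ g, φ i g * π i ε = π i ε := fun g ↦ by
      change π i _ * π i ε = _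
      rw [← map_mul]
      exact congrArg _ (hl g)
    have hr' : ∀ g, π i ε * φ i g = π i ε := fun g ↦ by
      change π i ε * π i _ = _
      rw [← map_mul]
      exact congrArg _ (hr g)
    obtain ⟨c, hc⟩ := hscalar i _ fun g ↦ (hl' g).trans (hr' g).symm
    have hc0 : c ≠ 0 := by rintro rfl; rw [map_zero] at hc; exact hi hc
    refine ⟨i, MonoidHom.ext fun g ↦ ?_⟩
    have := hl' g
    rw [hc, Algebra.algebraMap_eq_smul_one, mul_smul_comm, mul_one] at this
    exact smul_right_injective _ hc0 this
  refine ⟨n, d, φ, fun i ↦ (hd i).ne, fun x hx ↦ ?_, hscalar, i₀, hdim i₀ hi₀,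
    fun i ↦ ⟨fun h ↦ huniq _ _ h hi₀, fun h ↦ h ▸ hi₀⟩⟩
  simp only [hφ]
  rw [← trace_mulLeft_pi_matrix, ← trace_mulLeft_single hx, ← LinearMap.trace_conj' _ e.toLinearEquiv]
  congr 1
  refine LinearMap.ext fun a ↦ ?_
  simp [LinearEquiv.conj_apply]

section
open scoped commutatorElement

lemma isIntegral_classSize_mul_trace_div {G : Type*} [Group G] [Finite G] {d : ℕ}
    (φ : G →* Matrix (Fin d) (Fin d) ℂ) (hd : d ≠ 0)
    (hφ : ∀ M, (∀ g, φ g * M = M * φ g) → ∃ c : ℂ, M = algebraMap ℂ _ c) (x : G) :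
    IsIntegral ℤ ((classSize x : ℂ) * (φ x).trace / d) := by
  have := Fintype.ofFinite G
  let S : Finset G := Finset.univ.filter (IsConj x)
  have hS : ∀ y, y ∈ S ↔ IsConj x y := by simp [S]
  let ω : MonoidAlgebra ℤ G := ∑ y ∈ S, MonoidAlgebra.single y 1
  let Φ : MonoidAlgebra ℤ G →ₐ[ℤ] Matrix (Fin d) (Fin d) ℂ := MonoidAlgebra.lift ℤ _ G φ
  have hΦ : Φ ω = ∑ y ∈ S, φ y := by simp [Φ, ω, map_sum]
  have hfin : Module.Finite ℤ (MonoidAlgebra ℤ G) := .of_basis (MonoidAlgebra.basis G ℤ)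
  have hint : IsIntegral ℤ (Φ ω) := (IsIntegral.of_finite ℤ ω).map Φ
  obtain ⟨c, hc⟩ := hφ (Φ ω) fun g ↦ by
    rw [hΦ, Finset.mul_sum, Finset.sum_mul]
    refine Finset.sum_bij' (fun y _ ↦ g * y * g⁻¹) (fun y _ ↦ g⁻¹ * y * g) ?_ ?_ ?_ ?_ ?_
    · intro y hy
      exact (hS _).2 (((hS _).1 hy).trans (isConj_iff.2 ⟨g, rfl⟩))
    · intro y hy
      exact (hS _).2 (((hS _).1 hy).trans (isConj_iff.2 ⟨g⁻¹, by simp⟩))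
    · intro y _; group
    · intro y _; group
    · intro y _
      rw [← map_mul, ← map_mul]
      congr 1; group
  have hcint : IsIntegral ℤ c := by
    have : NeZero d := ⟨hd⟩
    rw [hc] at hint
    exact (isIntegral_algHom_iff ((Algebra.ofId ℂ (Matrix (Fin d) (Fin d) ℂ)).restrictScalars ℤ)
      (algebraMap ℂ (Matrix (Fin d) (Fin d) ℂ)).injective).1 hint
  have htr : (classSize x : ℂ) * (φ x).trace = d * c := by
    have h1 := congrArg Matrix.trace hc
    rw [hΦ, Matrix.trace_sum, Finset.sum_congr rfl (g := fun _ ↦ (φ x).trace)] at h1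
    · have hcard : S.card = classSize x := by
        rw [classSize, Nat.card_eq_fintype_card, Fintype.card_subtype]
      rw [Finset.sum_const, hcard, nsmul_eq_mul] at h1
      rw [h1, Algebra.algebraMap_eq_smul_one, Matrix.trace_smul, Matrix.trace_one]
      simp [mul_comm]
    · intro y hy
      obtain ⟨g, rfl⟩ := isConj_iff.1 ((hS _).1 hy)
      rw [map_mul, Matrix.trace_mul_comm, ← map_mul]
      simp
  have hd' : (d : ℂ) ≠ 0 := by exact_mod_cast hd
  rwa [htr, mul_div_cancel_left₀ _ hd']

lemma isIntegral_trace_of_pow_eq_one {n d : ℕ} (hn : 0 < n) (M : Matrix (Fin d) (Fin d) ℂ)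
    (hM : M ^ n = 1) : IsIntegral ℤ M.trace := by
  rw [Matrix.trace_eq_sum_roots_charpoly]
  exact isIntegral_sum_of_pow_eq_one hn _ (pow_eq_one_of_mem_roots_charpoly M hM)

/-- Burnside: an irreducible representation whose degree is prime to the size of the class of `x`
either has a character vanishing at `x` or maps `x` to a scalar. -/
lemma trace_eq_zero_or_scalar_of_coprime {G : Type*} [Group G] [Finite G] {d : ℕ}
    (φ : G →* Matrix (Fin d) (Fin d) ℂ) (hd : d ≠ 0)
    (hφ : ∀ M, (∀ g, φ g * M = M * φ g) → ∃ c : ℂ, M = algebraMap ℂ _ c) (x : G)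
    (hcop : (classSize x).Coprime d) :
    (φ x).trace = 0 ∨ ∃ c : ℂ, φ x = algebraMap ℂ _ c := by
  have hn : 0 < Nat.card G := Nat.card_pos
  have hd' : (d : ℂ) ≠ 0 := by exact_mod_cast hd
  have hpow : φ x ^ Nat.card G = 1 := by rw [← map_pow, pow_card_eq_one', map_one]
  have hroots := pow_eq_one_of_mem_roots_charpoly (φ x) hpow
  have hcard : (φ x).charpoly.roots.card = d := by
    rw [← (IsAlgClosed.splits (φ x).charpoly).natDegree_eq_card_roots,
      Matrix.charpoly_natDegree_eq_dim, Fintype.card_fin]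
  have hint : IsIntegral ℤ ((φ x).trace / d) := by
    obtain ⟨u, v, huv⟩ := (Nat.isCoprime_iff_coprime.2 hcop)
    have huv' : (u : ℂ) * classSize x + v * d = 1 := by exact_mod_cast huv
    have : (φ x).trace / d = u * (classSize x * (φ x).trace / d) + v * (φ x).trace := by
      field_simp
      linear_combination (-(φ x).trace) * huv'
    rw [this]
    exact ((isIntegral_algebraMap (x := u)).mul (isIntegral_classSize_mul_trace_div φ hd hφ x)).add
      ((isIntegral_algebraMap (x := v)).mul (isIntegral_trace_of_pow_eq_one hn _ hpow))
  rw [Matrix.trace_eq_sum_roots_charpoly] at hint ⊢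
  rcases sum_eq_zero_or_forall_eq_of_isIntegral_div hn _ hroots (by rwa [hcard]) with h | h
  · exact .inl h
  · exact .inr ⟨_, eq_scalar_of_pow_eq_one hn _ hpow _ h⟩

/-- Burnside: a nontrivial element whose class has prime power size becomes central in a
nontrivial quotient. -/
lemma exists_normal_ne_top_commutator_mem {G : Type*} [Group G] [Finite G] {q k : ℕ}
    [hq : Fact q.Prime] {x : G} (hx : x ≠ 1) (hcl : classSize x = q ^ k) :
    ∃ K : Subgroup G, K.Normal ∧ K ≠ ⊤ ∧ ∀ g : G, ⁅g, x⁆ ∈ K := by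
  obtain ⟨n, d, φ, hd, hsum, hφ, i₀, hi₀, htriv⟩ := exists_matrix_representations G
  by_contra! hno
  have hns : ∀ i, i ≠ i₀ → ¬ ∃ c : ℂ, φ i x = algebraMap ℂ _ c := by
    rintro i hi ⟨c, hc⟩
    obtain ⟨g, hg⟩ := hno (φ i).ker inferInstance fun h ↦ hi ((htriv i).1
      (MonoidHom.ext fun g ↦ MonoidHom.mem_ker.1 (h ▸ Subgroup.mem_top g)))
    refine hg ?_
    rw [MonoidHom.mem_ker, commutatorElement_def, map_mul, map_mul, map_mul, hc,
      ← Algebra.commutes c (φ i g), mul_assoc (algebraMap ℂ _ c), ← map_mul, mul_inv_cancel,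
      map_one, mul_one, ← hc, ← map_mul, mul_inv_cancel, map_one]
  have hdvd : ∀ i, i ≠ i₀ → ∃ z : ℂ, IsIntegral ℤ z ∧ (d i : ℂ) * (φ i x).trace = q * z := by
    intro i hi
    by_cases hqd : q ∣ d i
    · obtain ⟨m, hm⟩ := hqd
      refine ⟨m * (φ i x).trace, ?_, by
        rw [show (d i : ℂ) = q * m by exact_mod_cast hm]; ring⟩
      exact (isIntegral_algebraMap (x := (m : ℤ))).mul (isIntegral_trace_of_pow_eq_one
        (Nat.card_pos (α := G)) _ (by rw [← map_pow, pow_card_eq_one', map_one]))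
    · refine ⟨0, isIntegral_zero, ?_⟩
      rcases trace_eq_zero_or_scalar_of_coprime (φ i) (hd i) (hφ i) x
        (hcl ▸ Nat.Coprime.pow_left k ((Nat.Prime.coprime_iff_not_dvd hq.out).2 hqd)) with h | h
      · rw [h, mul_zero, mul_zero]
      · exact absurd h (hns i hi)
  choose! z hz hzeq using hdvd
  have hs := hsum x hx
  have h0 : (d i₀ : ℂ) * (φ i₀ x).trace = 1 := by
    rw [(htriv i₀).2 rfl]
    simp [hi₀]
  rw [← Finset.add_sum_erase _ _ (Finset.mem_univ i₀), h0,
    Finset.sum_congr rfl fun i hi ↦ hzeq i (Finset.ne_of_mem_erase hi), ← Finset.mul_sum] at hs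
  set Z := ∑ i ∈ Finset.univ.erase i₀, z i with hZ
  have hZint : IsIntegral ℤ Z := IsIntegral.sum _ fun i hi ↦ hz i (Finset.ne_of_mem_erase hi)
  have hq0 : (q : ℚ) ≠ 0 := by exact_mod_cast hq.out.ne_zero
  have hZq : Z = algebraMap ℚ ℂ (-1 / q) := by
    have : (q : ℂ) ≠ 0 := by exact_mod_cast hq.out.ne_zero
    simp only [map_div₀, map_neg, map_one, map_natCast]
    field_simp
    linear_combination hs
  rw [hZq, isIntegral_algebraMap_iff (algebraMap ℚ ℂ).injective, IsIntegrallyClosed.isIntegral_iff]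
    at hZint
  obtain ⟨y, hy⟩ := hZint
  rw [eq_div_iff hq0, eq_intCast] at hy
  have hy' : y * (q : ℤ) = -1 := by exact_mod_cast hy
  have : (q : ℤ) ∣ 1 := ⟨-y, by linear_combination hy'⟩
  exact hq.out.one_lt.ne' (by exact_mod_cast Int.eq_one_of_dvd_one (by positivity) this)

end

section NormalPSubgroups

variable {G : Type*} [Group G] {p q : ℕ}

/-- The largest normal `q`-subgroup is characteristic, so if `G` has no nontrivial normal
`q`-subgroup then neither does any normal subgroup of `G`. -/
lemma eq_bot_of_isPGroup_of_normal_in_normal [Finite G]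
    (hG : ∀ R : Subgroup G, R.Normal → IsPGroup q R → R = ⊥) (N : Subgroup G) [N.Normal]
    [Fact q.Prime] (R : Subgroup N) (hR : R.Normal) (hRq : IsPGroup q R) : R = ⊥ := by
  let S : Subgroup N := sSup {H | H.Normal ∧ IsPGroup q H}
  have hSq : IsPGroup q S := Sylow.sSup_of_normal _ (fun H hH ↦ hH.2) fun H hH ↦ hH.1
  have hS : S.Characteristic := by
    rw [Subgroup.characteristic_iff_map_le]
    intro φ
    rw [Subgroup.map_le_iff_le_comap]
    refine sSup_le fun H hH ↦ ?_
    rw [← Subgroup.map_le_iff_le_comap]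
    exact le_sSup ⟨hH.1.map _ φ.surjective, hH.2.map _⟩
  have h := hG (S.map N.subtype) inferInstance (hSq.map _)
  rw [Subgroup.map_eq_bot_iff_of_injective _ N.subtype_injective] at h
  exact le_bot_iff.1 (h ▸ le_sSup (show R ∈ {H : Subgroup N | H.Normal ∧ IsPGroup q H} from ⟨hR, hRq⟩))

lemma normal_of_subgroupOf_normal [Finite G] [Fact p.Prime] {P N : Subgroup G} [N.Normal]
    (hPN : P ≤ N) (hP : IsPGroup p P) (hidx : ¬ p ∣ P.relIndex N) (h : (P.subgroupOf N).Normal) :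
    P.Normal := by
  let T : Sylow p N := (hP.comap_subtype : IsPGroup p (P.subgroupOf N)).toSylow hidx
  have hT : (T : Subgroup N) = P.subgroupOf N := rfl
  have : (T : Subgroup N).Characteristic := T.characteristic_of_normal (hT ▸ h)
  rw [hT] at this
  have h2 : ((P.subgroupOf N).map N.subtype).Normal := inferInstance
  rwa [Subgroup.subgroupOf_map_subtype, inf_eq_left.2 hPN] at h2

lemma comap_mk_eq_of_le_center [Finite G] [Fact q.Prime]
    (hG : ∀ R : Subgroup G, R.Normal → IsPGroup q R → R = ⊥) (D : Subgroup G) [D.Normal]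
    (hD : D ≤ Subgroup.center G) (R : Subgroup (G ⧸ D)) (hR : R.Normal) (hRq : IsPGroup q R) :
    R = ⊥ := by
  let M := R.comap (QuotientGroup.mk' D)
  have hM : M.Normal := hR.comap _
  have hDM : D ≤ M := fun x hx ↦ by
    rw [Subgroup.mem_comap, QuotientGroup.mk'_apply, (QuotientGroup.eq_one_iff x).2 hx]
    exact R.one_mem
  have hmap : M.map (QuotientGroup.mk' D) = R :=
    Subgroup.map_comap_eq_self_of_surjective (QuotientGroup.mk'_surjective D) R
  obtain ⟨j, hj⟩ := IsPGroup.iff_card.1 hRq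
  have hidx : (D.subgroupOf M).index = q ^ j := by
    rw [← hj, ← Subgroup.relIndex_bot_left, ← hmap, ← Subgroup.relIndex_comap,
      MonoidHom.comap_bot, QuotientGroup.ker_mk']
    rfl
  let T : Sylow q M := default
  have htop := sup_eq_top_of_index_eq_pow T _ hidx
  have hnorm : (T : Subgroup M).Normal := by
    rw [← Subgroup.normalizer_eq_top_iff, eq_top_iff, ← htop]
    refine sup_le Subgroup.le_normalizer fun x hx ↦ Subgroup.mem_normalizer_iff.2 fun y ↦ ?_
    have hxy : x * y = y * x :=
      Subtype.ext (Subgroup.mem_center_iff.1 (hD (Subgroup.mem_subgroupOf.1 hx)) y).symm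
    rw [hxy, mul_inv_cancel_right]
  have hbot := eq_bot_of_isPGroup_of_normal_in_normal hG M _ hnorm T.isPGroup'
  rw [hbot, bot_sup_eq, Subgroup.subgroupOf_eq_top] at htop
  rw [← hmap, Subgroup.map_eq_bot_iff, QuotientGroup.ker_mk']
  exact htop

lemma card_quotient_lt [Finite G] {D : Subgroup G} (hD : D ≠ ⊥) :
    Nat.card (G ⧸ D) < Nat.card G := by
  have h := D.card_eq_card_quotient_mul_card_subgroup
  have h1 := D.one_lt_card_iff_ne_bot.2 hD
  have h2 : 0 < Nat.card (G ⧸ D) := Nat.card_pos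
  nlinarith

lemma exists_index_map_eq_pow {H : Type*} [Group H] [Finite G] (hq : q.Prime) (f : G →* H)
    (hf : Function.Surjective f) {P : Subgroup G} (hP : ∃ k, P.index = q ^ k) :
    ∃ k, (P.map f).index = q ^ k := by
  obtain ⟨k, hk⟩ := hP
  obtain ⟨l, -, hl⟩ := (Nat.dvd_prime_pow hq).1 (hk ▸ P.index_map_dvd hf)
  exact ⟨l, hl⟩

lemma commute_map {H : Type*} [Group H] (f : G →* H) {P : Subgroup G}
    (hP : ∀ x ∈ P, ∀ y ∈ P, x * y = y * x) : ∀ x ∈ P.map f, ∀ y ∈ P.map f, x * y = y * x := by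
  rintro _ ⟨x, hx, rfl⟩ _ ⟨y, hy, rfl⟩
  rw [← map_mul, hP x hx y hy, map_mul]

/-- In a finite group with an abelian `p`-subgroup `P` of `q`-power index, `P` becomes normal
modulo a normal `q`-subgroup. -/
theorem exists_normal_isPGroup_sup_normal [Finite G] [hp : Fact p.Prime] [hq : Fact q.Prime]
    (hpq : p ≠ q) (P : Subgroup G) (hP : IsPGroup p P)
    (hc : ∀ x ∈ P, ∀ y ∈ P, x * y = y * x) (hidx : ∃ k, P.index = q ^ k) :
    ∃ R : Subgroup G, R.Normal ∧ IsPGroup q R ∧ (R ⊔ P).Normal := by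
  induction hn : Nat.card G using Nat.strong_induction_on generalizing G with
  | _ n ih =>
  subst hn
  by_cases hG : ∀ R : Subgroup G, R.Normal → IsPGroup q R → R = ⊥
  swap
  · push Not at hG
    obtain ⟨R, hR, hRq, hR1⟩ := hG
    obtain ⟨S, hS, hSq, hSP⟩ := ih _ (card_quotient_lt hR1) (P.map (QuotientGroup.mk' R)) (hP.map _)
      (commute_map _ hc)
      (exists_index_map_eq_pow hq.out _ (QuotientGroup.mk'_surjective R) hidx) rfl
    refine ⟨S.comap (QuotientGroup.mk' R), hS.comap _, ?_, ?_⟩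
    · exact hSq.comap_of_ker_isPGroup _ (by rwa [QuotientGroup.ker_mk'])
    · have : S.comap (QuotientGroup.mk' R) ⊔ P = (S ⊔ P.map (QuotientGroup.mk' R)).comap
          (QuotientGroup.mk' R) := by
        have hRS : R ≤ S.comap (QuotientGroup.mk' R) :=
          (QuotientGroup.ker_mk' R).ge.trans (MonoidHom.ker_le_comap _ _)
        conv_rhs => rw [← Subgroup.map_comap_eq_self_of_surjective
          (QuotientGroup.mk'_surjective R) S]
        rw [← Subgroup.map_sup, Subgroup.comap_map_eq, QuotientGroup.ker_mk',
          sup_eq_left.2 (hRS.trans le_sup_left)]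
      rw [this]
      exact hSP.comap _
  obtain ⟨k, hk⟩ := hidx
  have hndvd : ∀ m, m ∣ P.index → ¬ p ∣ m := fun m hm hpm ↦
    hpq ((Nat.prime_dvd_prime_iff_eq hp.out hq.out).1
      (hp.out.dvd_of_dvd_pow (hk ▸ hpm.trans hm)))
  have hsub : ∀ N : Subgroup G, N.Normal → N ≠ ⊤ → (P ⊓ N).Normal := by
    intro N hN hNtop
    have hrel : P.relIndex N ∣ P.index := relIndex_dvd_index_of_normal_right P N
    obtain ⟨l, -, hl⟩ := (Nat.dvd_prime_pow hq.out).1 (hk ▸ hrel)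
    obtain ⟨R, hR, hRq, hRP⟩ := ih (Nat.card N)
      (lt_of_le_of_ne N.card_le_card_group fun h ↦ hNtop (N.eq_top_of_card_eq h)) (P.subgroupOf N)
      (hP.comap_subtype) (fun x hx y hy ↦ Subtype.ext (hc x hx y hy)) ⟨l, hl⟩ rfl
    rw [eq_bot_of_isPGroup_of_normal_in_normal hG N R hR hRq, bot_sup_eq,
      ← Subgroup.inf_subgroupOf_right] at hRP
    refine normal_of_subgroupOf_normal inf_le_right (hP.to_le inf_le_left) ?_ hRP
    rw [Subgroup.inf_relIndex_right]
    exact hndvd _ hrel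
  by_cases hPbot : P = ⊥
  · refine ⟨⊤, inferInstance, ?_, by rw [top_sup_eq]; infer_instance⟩
    rw [hPbot, Subgroup.index_bot] at hk
    exact IsPGroup.of_card (n := k) (by rw [Subgroup.card_top, hk])
  refine ⟨⊥, inferInstance, IsPGroup.of_bot, ?_⟩
  rw [bot_sup_eq]
  obtain ⟨D, hD, hDP, hDbot⟩ : ∃ D : Subgroup G, D.Normal ∧ D ≤ P ∧ D ≠ ⊥ := by
    obtain ⟨x, hxP, hx⟩ := P.bot_or_exists_ne_one.resolve_left hPbot
    have hPx : P ≤ Subgroup.centralizer {x} := fun y hy ↦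
      Subgroup.mem_centralizer_singleton_iff.2 (hc x hxP y hy).symm
    obtain ⟨l, -, hl⟩ := (Nat.dvd_prime_pow hq.out).1 (hk ▸ Subgroup.index_dvd_of_le hPx)
    obtain ⟨K, hK, hKtop, hxK⟩ := exists_normal_ne_top_commutator_mem hx
      ((classSize_eq_index_centralizer x).trans hl)
    by_cases hPK : P ⊓ K = ⊥
    · have hKq : IsPGroup q K := by
        obtain ⟨m, -, hm⟩ := (Nat.dvd_prime_pow hq.out).1
          (hk ▸ relIndex_dvd_index_of_normal_right P K)
        have h := card_inf_mul_relIndex K P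
        rw [inf_comm, hPK, Subgroup.card_bot, one_mul, hm] at h
        exact IsPGroup.of_card h.symm
      rw [hG K hK hKq] at hxK
      have hxZ : x ∈ Subgroup.center G := Subgroup.mem_center_iff.2 fun g ↦
        commutatorElement_eq_one_iff_mul_comm.1 (Subgroup.mem_bot.1 (hxK g))
      refine ⟨Subgroup.zpowers x, ?_, by simpa using hxP, by simpa using hx⟩
      have hle : Subgroup.zpowers x ≤ Subgroup.center G := by simpa using hxZ
      exact ⟨fun y hy g ↦ by rwa [Subgroup.mem_center_iff.1 (hle hy), mul_inv_cancel_right]⟩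
    · exact ⟨P ⊓ K, hsub K hK hKtop, inf_le_left, hPK⟩
  by_cases hCtop : Subgroup.centralizer (D : Set G) = ⊤
  · have hDZ : D ≤ Subgroup.center G := Subgroup.centralizer_eq_top_iff_subset.1 hCtop
    obtain ⟨S, hS, hSq, hSP⟩ := ih _ (card_quotient_lt hDbot) (P.map (QuotientGroup.mk' D)) (hP.map _)
      (commute_map _ hc)
      (exists_index_map_eq_pow hq.out _ (QuotientGroup.mk'_surjective D) ⟨k, hk⟩) rfl
    rw [comap_mk_eq_of_le_center hG D hDZ S hS hSq, bot_sup_eq] at hSP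
    have h2 := hSP.comap (QuotientGroup.mk' D)
    rwa [Subgroup.comap_map_eq, QuotientGroup.ker_mk', sup_eq_left.2 hDP] at h2
  · have h2 := hsub _ inferInstance hCtop
    rwa [inf_eq_left.2 fun x hx ↦ Subgroup.mem_centralizer_iff.2 fun y hy ↦ hc y (hDP hy) x hx] at h2

end NormalPSubgroups

section Assembly

variable {G V : Type*} [Group G] [Finite G] [AddCommGroup V] [Module ℂ V]
  [FiniteDimensional ℂ V] [Nontrivial V] {p q : ℕ} [Fact p.Prime] [Fact q.Prime]

lemma exists_finrank_dvd_classSize_of_injective (hpq : p ≠ q) {ρ : Representation ℂ G V}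
    (hρ : NoImprimitivity ρ) (hs : ScalarCommutant ρ ⊤) (hinj : Function.Injective ρ)
    (P : Subgroup G) (hP : IsPGroup p P) (hidx : ∃ k, P.index = q ^ k)
    (hPc : P.Normal ∨ ∀ x ∈ P, ∀ y ∈ P, x * y = y * x) :
    ∃ g : G, Module.finrank ℂ V ∣ classSize g := by
  obtain ⟨k, hk⟩ := hidx
  rcases hPc with hPn | hPc
  · let X : Sylow q G := default
    have htop : P ⊔ X = ⊤ := by rw [sup_comm]; exact sup_eq_top_of_index_eq_pow X P hk
    exact finrank_dvd_classSize_of_injective hpq hρ hs hinj P X hP X.isPGroup'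
      (htop ▸ inferInstance) ⟨0, by rw [htop, Subgroup.index_top, pow_zero]⟩ (.inr htop)
  · obtain ⟨R, hR, hRq, hRP⟩ := exists_normal_isPGroup_sup_normal hpq P hP hPc ⟨k, hk⟩
    obtain ⟨l, -, hl⟩ := (Nat.dvd_prime_pow Fact.out).1
      (hk ▸ Subgroup.index_dvd_of_le (le_sup_right : P ≤ R ⊔ P))
    exact finrank_dvd_classSize_of_injective hpq.symm hρ hs hinj R P hRq hP hRP ⟨l, hl⟩ (.inl hPc)

lemma exists_finrank_dvd_classSize (hpq : p ≠ q) {ρ : Representation ℂ G V}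
    (hρ : NoImprimitivity ρ) (hs : ScalarCommutant ρ ⊤)
    (P : Subgroup G) (hP : IsPGroup p P) (hidx : ∃ k, P.index = q ^ k)
    (hPc : P.Normal ∨ ∀ x ∈ P, ∀ y ∈ P, x * y = y * x) :
    ∃ g : G, Module.finrank ℂ V ∣ classSize g := by
  let N : Subgroup G := MonoidHom.ker ρ
  let π := QuotientGroup.mk' N
  have hπ : Function.Surjective π := QuotientGroup.mk'_surjective N
  let σ : Representation ℂ (G ⧸ N) V := QuotientGroup.lift N ρ fun _ hg ↦ hg
  have hσ : ∀ g, σ (π g) = ρ g := fun _ ↦ rfl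
  obtain ⟨g, hg⟩ := exists_finrank_dvd_classSize_of_injective hpq (ρ := σ)
    (fun e he he0 h ↦ hρ e he he0 fun g ↦ h (π g))
    (fun T hT ↦ hs T fun g _ ↦ hT (π g) (Subgroup.mem_top _))
    ((injective_iff_map_eq_one σ).2 fun x hx ↦ by
      obtain ⟨g, rfl⟩ := hπ x
      exact (QuotientGroup.eq_one_iff g).2 hx)
    (P.map π) (hP.map π) (exists_index_map_eq_pow Fact.out π hπ hidx)
    (hPc.imp (fun h ↦ h.map π hπ) (commute_map π))
  obtain ⟨g, rfl⟩ := hπ g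
  exact ⟨g, hg.trans (classSize_map_dvd π hπ g)⟩

lemma exists_index_eq_pow {a b : ℕ} (hcard : Nat.card G = p ^ a * q ^ b)
    (P : Sylow p G) : ∃ k, (P : Subgroup G).index = q ^ k := by
  have hp : p.Prime := Fact.out
  have h1 : (P : Subgroup G).index ∣ p ^ a * q ^ b := hcard ▸ (P : Subgroup G).index_dvd_card
  have h2 := (((hp.coprime_iff_not_dvd.2 P.not_dvd_index).pow_left a).symm).dvd_of_dvd_mul_left h1
  obtain ⟨k, -, hk⟩ := (Nat.dvd_prime_pow Fact.out).1 h2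
  exact ⟨k, hk⟩

lemma exists_finrank_dvd_classSize_of_sylow (hpq : p ≠ q) {a b : ℕ}
    (hcard : Nat.card G = p ^ a * q ^ b) {ρ : Representation ℂ G V}
    (hρ : NoImprimitivity ρ) (hs : ScalarCommutant ρ ⊤) (P : Sylow p G)
    (hP : (P : Subgroup G).Normal ∨ ∀ x y : (P : Subgroup G), x * y = y * x) :
    ∃ g : G, Module.finrank ℂ V ∣ classSize g :=
  exists_finrank_dvd_classSize hpq hρ hs P P.isPGroup' (exists_index_eq_pow hcard P)
    (hP.imp_right fun h x hx y hy ↦ congrArg Subtype.val (h ⟨x, hx⟩ ⟨y, hy⟩))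

end Assembly

theorem primitive_char_dvd_class_size_of_normal_or_abelian_sylow {G : Type*} [Group G]
    [Fintype G] (p q : ℕ) (hp : p.Prime) (hq : q.Prime) (hpq : p ≠ q) (a b : ℕ)
    (hcard : Fintype.card G = p ^ a * q ^ b) (hodd : Odd (Fintype.card G))
    (hsyl : (∃ P : Sylow p G, (P : Subgroup G).Normal ∨
               ∀ x y : (P : Subgroup G), x * y = y * x) ∨
            (∃ Q : Sylow q G, (Q : Subgroup G).Normal ∨
               ∀ x y : (Q : Subgroup G), x * y = y * x))
    (χ : G → ℂ) (hχ : IsPrimitiveChar χ)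
    (d : ℕ) (hd : χ 1 = (d : ℂ)) :
    ∃ g : G, d ∣ classSize g := by
  have : Fact p.Prime := ⟨hp⟩
  have : Fact q.Prime := ⟨hq⟩
  obtain ⟨V, _, _, _, ρ, _, hs, hρ, hχ1⟩ := exists_representation_of_isPrimitiveChar hχ
  obtain rfl : d = Module.finrank ℂ V := Nat.cast_injective (hd.symm.trans hχ1)
  rw [← Nat.card_eq_fintype_card] at hcard
  rcases hsyl with ⟨P, hP⟩ | ⟨Q, hQ⟩
  · exact exists_finrank_dvd_classSize_of_sylow hpq hcard hρ hs P hP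
  · exact exists_finrank_dvd_classSize_of_sylow hpq.symm (hcard.trans (mul_comm _ _)) hρ hs Q hQ
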